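/- arXiv:1205.4314 — 10 statements merged into one kernel-verified Lean document; each statement's English description precedes it below -/
import Mathlib

section
/- For every c₀ > 0 there exists a constant C > 0 such that for every Δt > 0, ∑_{k=1}^∞ (1 − e^{-c₀ λ_k⁴ Δt})/λ_k² ≤ C · (Δt^{3/4} + 1) · Δt^{1/4}. -/
noncomputable def lam (k : ℕ) : ℝ := (k : ℝ) * Real.pi

theorem aux_u (u : ℝ) (hu : 0 < u) : (1 - Real.exp (-(u ^ 4))) * (1 + u) ^ 2 ≤ 4 * u ^ 2 := by
  have h1 : 1 - Real.exp (-(u ^ 4)) ≤ u ^ 4 := by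
    have := Real.add_one_le_exp (-(u ^ 4)); linarith
  have h2 : 1 - Real.exp (-(u ^ 4)) ≤ 1 := by
    have := Real.exp_pos (-(u ^ 4)); linarith
  rcases le_total u 1 with h | h
  · have h3 : (1 + u) ^ 2 ≤ 4 := by nlinarith
    have h4 : u ^ 4 ≤ u ^ 2 := pow_le_pow_of_le_one hu.le h (by norm_num)
    calc _ ≤ u ^ 4 * (1 + u) ^ 2 := by gcongr
      _ ≤ u ^ 2 * 4 := by gcongr
      _ = _ := by ring
  · calc _ ≤ 1 * (1 + u) ^ 2 := by gcongr
      _ ≤ _ := by nlinarith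

theorem aux_term (A : ℝ) (hA : 0 < A) (k : ℕ) :
    (1 - Real.exp (-((lam (k + 1) / A) ^ 4))) / lam (k + 1) ^ 2
      ≤ 4 * (1 / (A + k) - 1 / (A + (k + 1 : ℕ))) := by
  have hk : (0 : ℝ) ≤ k := Nat.cast_nonneg k
  have hl : (k : ℝ) + 1 ≤ lam (k + 1) := by
    unfold lam; push_cast; nlinarith [Real.pi_gt_three]
  set l := lam (k + 1)
  have hl0 : 0 < l := by linarith
  have h := aux_u (l / A) (by positivity)
  have h0 : 0 ≤ 1 - Real.exp (-((l / A) ^ 4)) := by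
    have : Real.exp (-((l / A) ^ 4)) ≤ 1 := Real.exp_le_one_iff.2 (by
      have : 0 ≤ (l / A) ^ 4 := by positivity
      linarith)
    linarith
  set e := 1 - Real.exp (-((l / A) ^ 4))
  have h5 : e * (A + l) ^ 2 ≤ 4 * l ^ 2 := by
    have e1 : e * (A + l) ^ 2 = (e * (1 + l / A) ^ 2) * A ^ 2 := by field_simp
    have e2 : 4 * l ^ 2 = (4 * (l / A) ^ 2) * A ^ 2 := by field_simp
    rw [e1, e2]; gcongr
  have e3 : 4 * (1 / (A + k) - 1 / (A + (k + 1 : ℕ))) = 4 / ((A + k) * (A + k + 1)) := by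
    have : A + (k : ℝ) ≠ 0 := by positivity
    have : A + (k : ℝ) + 1 ≠ 0 := by positivity
    have : A + ((k : ℝ) + 1) ≠ 0 := by positivity
    push_cast; field_simp; ring
  rw [e3, div_le_div_iff₀ (by positivity) (by positivity)]
  refine le_trans ?_ h5
  gcongr
  rw [sq]
  exact mul_le_mul (by linarith) (by linarith) (by positivity) (by positivity)

theorem aux_sum (A : ℝ) (hA : 0 < A) :
    ∑' k : ℕ, (1 - Real.exp (-((lam (k + 1) / A) ^ 4))) / lam (k + 1) ^ 2 ≤ 4 / A := by
  refine Real.tsum_le_of_sum_range_le (fun k => ?_) (fun n => ?_)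
  · refine div_nonneg ?_ (by positivity)
    have : Real.exp (-((lam (k + 1) / A) ^ 4)) ≤ 1 := Real.exp_le_one_iff.2 (by
      have : 0 ≤ (lam (k + 1) / A) ^ 4 := by positivity
      linarith)
    linarith
  · refine (Finset.sum_le_sum fun k _ => aux_term A hA k).trans ?_
    rw [← Finset.mul_sum, Finset.sum_range_sub' (fun k : ℕ => 1 / (A + (k : ℝ)))]
    have : 0 ≤ 1 / (A + (n : ℝ)) := by positivity
    have e : 4 / A = 4 * (1 / A) := by ring
    rw [e]
    simp only [Nat.cast_zero, add_zero]
    linarith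

/-- For every `c₀ > 0` there exists `C > 0` such that for every `Δt > 0`,
`∑_{k=1}^∞ (1 − e^{-c₀ λ_k⁴ Δt})/λ_k² ≤ C (Δt^{3/4} + 1) Δt^{1/4}`, where `λ_k = kπ`. -/
theorem stmt_2 (c₀ : ℝ) (hc₀ : 0 < c₀) :
    ∃ C > (0:ℝ), ∀ Δt : ℝ, 0 < Δt →
      ∑' k : ℕ, (1 - Real.exp (-(c₀ * lam (k + 1) ^ 4 * Δt))) / lam (k + 1) ^ 2
        ≤ C * (Δt ^ ((3:ℝ)/4) + 1) * Δt ^ ((1:ℝ)/4) := by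
  refine ⟨4 * c₀ ^ ((1:ℝ)/4), by positivity, fun t ht => ?_⟩
  have hp : ∀ x : ℝ, 0 < x → (x ^ ((1:ℝ)/4)) ^ 4 = x := fun x hx => by
    rw [← Real.rpow_natCast, ← Real.rpow_mul hx.le]; norm_num
  have hc := hp c₀ hc₀
  have hs := hp t ht
  have hc' : 0 < c₀ ^ ((1:ℝ)/4) := by positivity
  have hs' : 0 < t ^ ((1:ℝ)/4) := by positivity
  have h3 : 0 < t ^ ((3:ℝ)/4) := by positivity
  set a := c₀ ^ ((1:ℝ)/4)
  set s := t ^ ((1:ℝ)/4)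
  have h := aux_sum (1 / (a * s)) (by positivity)
  have e : ∀ k : ℕ, c₀ * lam (k + 1) ^ 4 * t = (lam (k + 1) / (1 / (a * s))) ^ 4 := fun k => by
    rw [div_div_eq_mul_div, div_one, mul_pow, mul_pow, hc, hs]; ring
  simp only [e]
  refine h.trans ?_
  rw [div_div_eq_mul_div, div_one]
  have : 0 ≤ a * s * t ^ ((3:ℝ)/4) := by positivity
  nlinarith
end

section
/- There exists a constant C > 0, depending only on μ, κ and T and independent of N⋆ and t, such that for every N⋆ ∈ ℕ and every t ∈ (0,T]: ∑_{k=1}^∞ λ_k² · Δt^{-2} · ∑_{n=1}^{N̂(t)} Ψ_n^k(t) ≤ C · (1 + Δt^{3/4}) · Δt^{1/4}. -/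
noncomputable def muK (μ : ℝ) (k : ℕ) : ℝ := lam k ^ 2 * (lam k ^ 2 - μ)

open MeasureTheory in
lemma aux_osc (f : ℝ → ℝ) (a b D : ℝ) (hab : a ≤ b)
    (h : ∀ s ∈ Set.Ioc a b, ∀ s' ∈ Set.Ioc a b, |f s - f s'| ≤ D) :
    ∫ s in a..b, (∫ s' in a..b, (f s - f s')) ^ 2 ≤ (b - a) ^ 3 * D ^ 2 := by
  have h1 : ‖∫ s in a..b, (∫ s' in a..b, (f s - f s')) ^ 2‖ ≤ (D * (b - a)) ^ 2 * |b - a| := by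
    apply intervalIntegral.norm_integral_le_of_norm_le_const
    intro s hs
    rw [Set.uIoc_of_le hab] at hs
    have h2 : ‖∫ s' in a..b, (f s - f s')‖ ≤ D * |b - a| := by
      apply intervalIntegral.norm_integral_le_of_norm_le_const
      intro s' hs'
      rw [Set.uIoc_of_le hab] at hs'
      exact h s hs s' hs'
    rw [abs_of_nonneg (sub_nonneg.2 hab)] at h2
    rw [norm_pow]
    exact pow_le_pow_left₀ (norm_nonneg _) h2 2
  rw [abs_of_nonneg (sub_nonneg.2 hab)] at h1
  calc _ ≤ _ := Real.le_norm_self _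
    _ ≤ _ := h1
    _ = _ := by ring

open MeasureTheory in
lemma aux_int (f : ℝ → ℝ) (a b : ℝ) (hab : a ≤ b) (hf : IntervalIntegrable f volume a b)
    (h0 : ∀ s ∈ Set.Icc a b, 0 ≤ f s) (h1 : ∀ s ∈ Set.Icc a b, f s ≤ 1) :
    ∫ s in a..b, (∫ s' in a..b, (f s - f s')) ^ 2 ≤ 2 * (b - a) ^ 2 * ∫ s in a..b, f s := by
  set F := ∫ s in a..b, f s with hF
  have hin : ∀ s, ∫ s' in a..b, (f s - f s') = (b - a) * f s - F := by
    intro s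
    rw [intervalIntegral.integral_sub (by simp) hf]
    simp [hF]
  have hF0 : 0 ≤ F := intervalIntegral.integral_nonneg hab h0
  have hF1 : F ≤ b - a := by
    have := intervalIntegral.integral_mono_on (μ := volume) hab hf
      (intervalIntegrable_const (c := (1:ℝ))) h1
    simpa using this
  have hba : 0 ≤ b - a := sub_nonneg.2 hab
  simp_rw [hin]
  have hR : IntervalIntegrable (fun s => (b - a) ^ 2 * f s + (b - a) * F) volume a b :=
    (hf.const_mul _).add (by simp)
  have hbd : ∀ s ∈ Set.Icc a b, ((b - a) * f s - F) ^ 2 ≤ (b - a) ^ 2 * f s + (b - a) * F := by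
    intro s hs
    have := h0 s hs
    have h1 := h1 s hs
    have e1 : F ^ 2 ≤ (b - a) * F := by nlinarith
    have e2 : (b - a) ^ 2 * f s ^ 2 ≤ (b - a) ^ 2 * f s :=
      mul_le_mul_of_nonneg_left (by nlinarith) (by positivity)
    have e3 : 0 ≤ (b - a) * f s * F := by positivity
    nlinarith
  have key : ∫ s in a..b, ((b - a) * f s - F) ^ 2 ≤
      ∫ s in a..b, ((b - a) ^ 2 * f s + (b - a) * F) := by
    by_cases hL : IntervalIntegrable (fun s => ((b - a) * f s - F) ^ 2) volume a b
    · exact intervalIntegral.integral_mono_on hab hL hR hbd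
    · rw [intervalIntegral.integral_undef hL]
      apply intervalIntegral.integral_nonneg hab
      intro s hs
      have := h0 s hs
      positivity
  refine key.trans (le_of_eq ?_)
  rw [intervalIntegral.integral_add (hf.const_mul _) (by simp),
    intervalIntegral.integral_const_mul, intervalIntegral.integral_const, ← hF]
  simp only [smul_eq_mul]
  ring

lemma aux_sum_s3 (F : ℕ → ℝ) (M : ℕ) :
    ∑ n ∈ Finset.Icc 1 M, F n = ∑ i ∈ Finset.range M, F (i + 1) := by
  induction M with
  | zero => simp
  | succ M ih => rw [Finset.sum_Icc_succ_top (by omega), ih, Finset.sum_range_succ]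

noncomputable def ff (m t s : ℝ) : ℝ :=
  (Set.Ioo (0:ℝ) t).indicator (fun _ => (1:ℝ)) s * Real.exp (-m * (t - s))

lemma ff_in {m t s : ℝ} (h0 : 0 < s) (h : s < t) : ff m t s = Real.exp (-m * (t - s)) := by
  unfold ff
  rw [Set.indicator_of_mem (show s ∈ Set.Ioo 0 t from ⟨h0, h⟩), one_mul]

lemma ff_out {m t s : ℝ} (h : ¬ (0 < s ∧ s < t)) : ff m t s = 0 := by
  unfold ff
  rw [Set.indicator_of_notMem (by simpa using h), zero_mul]

lemma ff_nonneg (m t s : ℝ) : 0 ≤ ff m t s := by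
  by_cases h : 0 < s ∧ s < t
  · rw [ff_in h.1 h.2]; positivity
  · rw [ff_out h]

lemma g_le {m t s Q T : ℝ} (hQ : 0 ≤ Q) (hm : -m ≤ Q) (ht : t ≤ T) (h0 : 0 ≤ s) (h : s ≤ t) :
    Real.exp (-m * (t - s)) ≤ Real.exp (Q * T) := by
  apply Real.exp_le_exp.2
  calc -m * (t - s) ≤ Q * (t - s) := mul_le_mul_of_nonneg_right hm (by linarith)
    _ ≤ Q * T := mul_le_mul_of_nonneg_left (by linarith) hQ

lemma ff_le {m t s Q T : ℝ} (hQ : 0 ≤ Q) (hm : -m ≤ Q) (ht : t ≤ T) :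
    ff m t s ≤ Real.exp (Q * T) := by
  by_cases h : 0 < s ∧ s < t
  · rw [ff_in h.1 h.2]; exact g_le hQ hm ht h.1.le h.2.le
  · rw [ff_out h]; positivity

open MeasureTheory in
lemma ff_intble (m t a b : ℝ) : IntervalIntegrable (ff m t) volume a b := by
  have hc : Continuous (fun s => Real.exp (-m * (t - s))) := by fun_prop
  have := hc.intervalIntegrable (μ := volume) a b
  have e : ff m t = (Set.Ioo (0:ℝ) t).indicator (fun s => Real.exp (-m * (t - s))) := by
    ext s
    unfold ff
    by_cases h : s ∈ Set.Ioo (0:ℝ) t <;> simp [h]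
  rw [e]
  exact ⟨this.1.indicator measurableSet_Ioo, this.2.indicator measurableSet_Ioo⟩

noncomputable def Psi (m t d : ℝ) (i : ℕ) : ℝ :=
  ∫ s in (i * d)..((i + 1) * d), (∫ s' in (i * d)..((i + 1) * d), (ff m t s - ff m t s')) ^ 2

lemma Psi_nonneg (m t d : ℝ) (hd : 0 < d) (i : ℕ) : 0 ≤ Psi m t d i := by
  unfold Psi
  apply intervalIntegral.integral_nonneg
  · nlinarith
  · intro s _; positivity

lemma bound1 (m t d Q T : ℝ) (hd : 0 < d) (hQ : 0 ≤ Q) (hm : -m ≤ Q) (ht0 : 0 < t) (ht : t ≤ T) :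
    ∑ i ∈ Finset.range (Nat.ceil (t / d)), Psi m t d i ≤ d ^ 2 * (2 * Real.exp (Q * T) ^ 2 * d) := by
  set E := Real.exp (Q * T) with hE
  have hE0 : 0 < E := Real.exp_pos _
  obtain ⟨M, hM⟩ : ∃ M, Nat.ceil (t / d) = M + 1 :=
    ⟨Nat.ceil (t / d) - 1, by have := Nat.ceil_pos.2 (div_pos ht0 hd); omega⟩
  have hMt : (M : ℝ) * d < t := by
    have : M < Nat.ceil (t / d) := by omega
    rw [Nat.lt_ceil] at this
    exact (lt_div_iff₀ hd).1 this
  rw [hM, Finset.sum_range_succ]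
  have last : Psi m t d M ≤ d ^ 3 * E ^ 2 := by
    have := aux_osc (ff m t) (M * d) ((M + 1) * d) E (by nlinarith) (by
      intro s _ s' _
      rw [abs_le]
      have h1 := ff_nonneg m t s
      have h2 := ff_nonneg m t s'
      have h3 := ff_le (s := s) hQ hm ht
      have h4 := ff_le (s := s') hQ hm ht
      constructor <;> linarith)
    unfold Psi
    refine this.trans (le_of_eq ?_)
    ring
  obtain ⟨σ, hσ, hmono⟩ : ∃ σ : ℝ, (σ = 1 ∨ σ = -1) ∧
      Monotone (fun s => σ * Real.exp (-m * (t - s))) := by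
    rcases le_total 0 m with h | h
    · refine ⟨1, Or.inl rfl, fun x y hxy => ?_⟩
      simp only [one_mul]
      apply Real.exp_le_exp.2
      nlinarith
    · refine ⟨-1, Or.inr rfl, fun x y hxy => ?_⟩
      simp only [neg_mul, one_mul, neg_le_neg_iff]
      apply Real.exp_le_exp.2
      nlinarith
  set g : ℝ → ℝ := fun s => σ * Real.exp (-m * (t - s)) with hg
  have habs : ∀ x y, |Real.exp (-m * (t - x)) - Real.exp (-m * (t - y))| = |g x - g y| := by
    intro x y
    simp only [hg, ← mul_sub, abs_mul]
    rcases hσ with h | h <;> simp [h]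
  have hdiff : ∀ x y, 0 ≤ x → x ≤ t → 0 ≤ y → y ≤ t → g x - g y ≤ E := by
    intro x y hx hx' hy hy'
    rw [← abs_of_pos hE0]
    refine (le_abs_self _).trans ?_
    rw [← habs, abs_of_pos hE0, abs_le]
    have h1 := g_le hQ hm ht hx hx'
    have h2 := g_le hQ hm ht hy hy'
    have h3 := Real.exp_pos (-m * (t - x))
    have h4 := Real.exp_pos (-m * (t - y))
    constructor <;> linarith
  have each : ∀ i ∈ Finset.range M, Psi m t d i ≤
      d ^ 3 * E * (g (((i + 1 : ℕ) : ℝ) * d) - g ((i : ℝ) * d)) := by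
    intro i hi
    have hi : i + 1 ≤ M := by simpa using hi
    have hit : ((i : ℝ) + 1) * d < t := by
      refine lt_of_le_of_lt ?_ hMt
      apply mul_le_mul_of_nonneg_right _ hd.le
      exact_mod_cast hi
    have hi0 : 0 ≤ (i : ℝ) * d := by positivity
    have := aux_osc (ff m t) (i * d) ((i + 1) * d) (g ((i + 1) * d) - g (i * d)) (by nlinarith) (by
      intro s hs s' hs'
      rw [ff_in (by linarith [hs.1]) (by linarith [hs.2]),
        ff_in (by linarith [hs'.1]) (by linarith [hs'.2]), habs, abs_le]
      have h1 := hmono hs.1.le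
      have h2 := hmono hs.2
      have h3 := hmono hs'.1.le
      have h4 := hmono hs'.2
      constructor <;> linarith)
    unfold Psi
    refine this.trans ?_
    push_cast
    have h1 : 0 ≤ g ((i + 1) * d) - g (i * d) := sub_nonneg.2 (hmono (by nlinarith))
    have h2 := hdiff ((i + 1) * d) (i * d) (by nlinarith) hit.le hi0 (by nlinarith)
    have h3 : ((i + 1) * d - i * d : ℝ) = d := by ring
    rw [h3, mul_assoc]
    apply mul_le_mul_of_nonneg_left _ (by positivity)
    nlinarith
  have h2 := Finset.sum_le_sum each
  rw [← Finset.mul_sum, Finset.sum_range_sub (fun i : ℕ => g ((i : ℝ) * d))] at h2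
  have h3 := hdiff ((M : ℝ) * d) (((0 : ℕ) : ℝ) * d) (by positivity) hMt.le (by simp)
    (by simpa using ht0.le)
  have h4 : d ^ 3 * E * (g ((M : ℝ) * d) - g (((0 : ℕ) : ℝ) * d)) ≤ d ^ 3 * E * E :=
    mul_le_mul_of_nonneg_left h3 (by positivity)
  nlinarith

open MeasureTheory in
lemma bound2 (m t d : ℝ) (hd : 0 < d) (hm : 0 < m) (ht0 : 0 < t) :
    ∑ i ∈ Finset.range (Nat.ceil (t / d)), Psi m t d i ≤ d ^ 2 * (2 / m) := by
  set M := Nat.ceil (t / d)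
  have hMt : t ≤ M * d := (div_le_iff₀ hd).1 (Nat.le_ceil _)
  have each : ∀ i ∈ Finset.range M, Psi m t d i ≤
      2 * d ^ 2 * ∫ s in ((i : ℝ) * d)..(((i + 1 : ℕ) : ℝ) * d), ff m t s := by
    intro i _
    have := aux_int (ff m t) (i * d) ((i + 1) * d) (by nlinarith) (ff_intble _ _ _ _)
      (fun s _ => ff_nonneg _ _ _) (fun s _ => by
        have := ff_le (m := m) (t := t) (s := s) (Q := 0) le_rfl (by linarith) le_rfl
        simpa using this)
    unfold Psi
    refine this.trans (le_of_eq ?_)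
    push_cast
    ring
  refine (Finset.sum_le_sum each).trans ?_
  rw [← Finset.mul_sum, intervalIntegral.sum_integral_adjacent_intervals
    (a := fun i : ℕ => (i : ℝ) * d) (fun k _ => ff_intble _ _ _ _)]
  have hc : Continuous (fun s => Real.exp (-m * (t - s))) := by fun_prop
  have h1 : ∫ s in (((0 : ℕ) : ℝ) * d)..((M : ℝ) * d), ff m t s ≤ 1 / m := by
    simp only [Nat.cast_zero, zero_mul]
    rw [← intervalIntegral.integral_add_adjacent_intervals (b := t) (ff_intble _ _ _ _)
      (ff_intble _ _ _ _)]
    have e1 : ∫ s in t..((M : ℝ) * d), ff m t s = 0 := by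
      apply intervalIntegral.integral_zero_ae
      refine Filter.Eventually.of_forall fun s hs => ?_
      rw [Set.uIoc_of_le hMt] at hs
      exact ff_out (fun h => by linarith [h.2, hs.1])
    have e2 : ∫ s in (0:ℝ)..t, ff m t s ≤ ∫ s in (0:ℝ)..t, Real.exp (-m * (t - s)) := by
      apply intervalIntegral.integral_mono_on ht0.le (ff_intble _ _ _ _)
        (hc.intervalIntegrable _ _)
      intro s _
      by_cases h : 0 < s ∧ s < t
      · rw [ff_in h.1 h.2]
      · rw [ff_out h]; positivity
    have e3 : ∫ s in (0:ℝ)..t, Real.exp (-m * (t - s)) =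
        Real.exp (-m * (t - t)) / m - Real.exp (-m * (t - 0)) / m := by
      apply intervalIntegral.integral_eq_sub_of_hasDerivAt (f := fun s => Real.exp (-m * (t - s)) / m)
      · intro s _
        have h := ((((hasDerivAt_id s).const_sub t).const_mul (-m)).exp).div_const m
        refine HasDerivAt.congr_deriv h ?_
        simp only [id]
        field_simp
      · exact hc.intervalIntegrable _ _
    have e4 : 0 < Real.exp (-m * (t - 0)) / m := by positivity
    rw [e1, add_zero]
    refine e2.trans ?_
    rw [e3]
    simp at e4 ⊢
    linarith
  calc _ ≤ 2 * d ^ 2 * (1 / m) := mul_le_mul_of_nonneg_left h1 (by positivity)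
    _ = _ := by ring

/-- the elementary telescoping bound -/
lemma aux_tel (x l A S : ℝ) (hx : 0 < x) (hl : Real.pi ≤ l) (hA : 0 ≤ A)
    (h1 : S ≤ A * x ^ 4) (h2 : S ≤ A / l ^ 4) :
    l ^ 2 * S ≤ 4 * A * x * (x * l / (1 + x * l) - x * (l - Real.pi) / (1 + x * (l - Real.pi))) := by
  have hpi := Real.pi_gt_three
  have hl0 : 0 < l := by linarith
  have hu : 0 < x * l := by positivity
  have hv : 0 ≤ x * (l - Real.pi) := mul_nonneg hx.le (by linarith)
  have e : x * l / (1 + x * l) - x * (l - Real.pi) / (1 + x * (l - Real.pi)) =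
      x * Real.pi / ((1 + x * l) * (1 + x * (l - Real.pi))) := by
    have : 1 + x * l ≠ 0 := by positivity
    have : 1 + x * (l - Real.pi) ≠ 0 := by positivity
    field_simp
    ring
  have e2 : x / (1 + x * l) ^ 2 ≤ x * Real.pi / ((1 + x * l) * (1 + x * (l - Real.pi))) := by
    apply div_le_div₀ (by positivity) (by nlinarith) (by positivity)
    rw [sq]
    apply mul_le_mul_of_nonneg_left _ (by positivity)
    nlinarith
  rw [e]
  refine le_trans ?_ (mul_le_mul_of_nonneg_left e2 (by positivity))
  have e3 : 4 * A * x * (x / (1 + x * l) ^ 2) = A * (4 * x ^ 2) / (1 + x * l) ^ 2 := by ring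
  rw [e3, le_div_iff₀ (by positivity)]
  rcases le_total (x * l) 1 with h | h
  · have a1 : (1 + x * l) ^ 2 ≤ 4 := by nlinarith
    have a2 : l ^ 2 * S ≤ A * x ^ 2 := by
      calc l ^ 2 * S ≤ l ^ 2 * (A * x ^ 4) := mul_le_mul_of_nonneg_left h1 (by positivity)
        _ = A * x ^ 2 * (x * l) ^ 2 := by ring
        _ ≤ A * x ^ 2 * 1 := mul_le_mul_of_nonneg_left (by nlinarith) (by positivity)
        _ = _ := by ring
    calc _ ≤ A * x ^ 2 * (1 + x * l) ^ 2 := mul_le_mul_of_nonneg_right a2 (by positivity)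
      _ ≤ A * x ^ 2 * 4 := mul_le_mul_of_nonneg_left a1 (by positivity)
      _ = _ := by ring
  · have a1 : (1 + x * l) ^ 2 ≤ 4 * (x * l) ^ 2 := by nlinarith
    have a2 : l ^ 2 * S ≤ A / l ^ 2 := by
      calc l ^ 2 * S ≤ l ^ 2 * (A / l ^ 4) := mul_le_mul_of_nonneg_left h2 (by positivity)
        _ = _ := by field_simp
    calc _ ≤ A / l ^ 2 * (1 + x * l) ^ 2 := mul_le_mul_of_nonneg_right a2 (by positivity)
      _ ≤ A / l ^ 2 * (4 * (x * l) ^ 2) := mul_le_mul_of_nonneg_left a1 (by positivity)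
      _ = _ := by field_simp

/-- There exists a constant `C > 0`, depending only on `μ`, `κ` and `T` and independent of
`N⋆` and `t`, such that for every `N⋆ ∈ ℕ` and every `t ∈ (0,T]`:
`∑_{k=1}^∞ λ_k² Δt^{-2} ∑_{n=1}^{N̂(t)} Ψ_n^k(t) ≤ C (1 + Δt^{3/4}) Δt^{1/4}`,
where `Δt = T/N⋆`, `t_n = nΔt`, `N̂(t) = min{ℓ : t ≤ t_ℓ} = ⌈t/Δt⌉`, and
`Ψ_n^k(t) = ∫_{T_n} (∫_{T_n} [𝟙_{(0,t)}(s) e^{-μ_k(t−s)} − 𝟙_{(0,t)}(s') e^{-μ_k(t−s')}] ds')² ds`. -/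
theorem stmt_3 (μ : ℝ) (κ : ℕ) (hκ : 1 ≤ κ)
    (hμl : ((κ : ℝ) - 1) ^ 2 * Real.pi ^ 2 ≤ μ) (hμu : μ < (κ : ℝ) ^ 2 * Real.pi ^ 2)
    (T : ℝ) (hT : 0 < T) :
    ∃ C > (0:ℝ), ∀ N : ℕ, 0 < N → ∀ t : ℝ, 0 < t → t ≤ T →
      ∑' k : ℕ,
          lam (k + 1) ^ 2 * ((T / N) ^ 2)⁻¹ *
            ∑ n ∈ Finset.Icc 1 (Nat.ceil (t / (T / N))),
              ∫ s in (((n : ℝ) - 1) * (T / N))..((n : ℝ) * (T / N)),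
                (∫ s' in (((n : ℝ) - 1) * (T / N))..((n : ℝ) * (T / N)),
                    ((Set.Ioo (0:ℝ) t).indicator (fun _ => (1:ℝ)) s *
                        Real.exp (-(muK μ (k + 1)) * (t - s)) -
                      (Set.Ioo (0:ℝ) t).indicator (fun _ => (1:ℝ)) s' *
                        Real.exp (-(muK μ (k + 1)) * (t - s')))) ^ 2
        ≤ C * (1 + (T / N) ^ ((3:ℝ)/4)) * (T / N) ^ ((1:ℝ)/4) := by
  have hpi := Real.pi_gt_three
  have hκ0 : (1:ℝ) ≤ κ := by exact_mod_cast hκ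
  have hμ0 : 0 ≤ μ := le_trans (by positivity) hμl
  set K : ℝ := (κ : ℝ) ^ 2 * Real.pi ^ 2 with hK
  have hK0 : 0 < K := by positivity
  set A1 : ℝ := 2 * Real.exp (μ ^ 2 * T) ^ 2 with hA1
  have hA10 : 0 < A1 := by positivity
  set c : ℝ := (K - μ) / K with hc
  have hc0 : 0 < c := div_pos (by linarith) hK0
  set A : ℝ := A1 + A1 * T * K ^ 2 + 2 / c with hA
  have hA0 : 0 < A := by positivity
  refine ⟨4 * A, by positivity, ?_⟩
  intro N hN t ht0 ht
  have hN1 : (1:ℝ) ≤ N := by exact_mod_cast hN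
  set d : ℝ := T / N with hd
  have hd0 : 0 < d := by positivity
  have hdT : d ≤ T := div_le_self hT.le hN1
  set x : ℝ := d ^ ((1:ℝ)/4) with hx
  have hx0 : 0 < x := by positivity
  have hx4 : x ^ 4 = d := by
    rw [hx, ← Real.rpow_natCast, ← Real.rpow_mul hd0.le]
    norm_num
  set S : ℕ → ℝ := fun k => (d ^ 2)⁻¹ *
    ∑ i ∈ Finset.range (Nat.ceil (t / d)), Psi (muK μ (k + 1)) t d i with hS
  have hterm : ∀ k : ℕ, lam (k + 1) ^ 2 * (d ^ 2)⁻¹ *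
            ∑ n ∈ Finset.Icc 1 (Nat.ceil (t / d)),
              ∫ s in (((n : ℝ) - 1) * d)..((n : ℝ) * d),
                (∫ s' in (((n : ℝ) - 1) * d)..((n : ℝ) * d),
                    ((Set.Ioo (0:ℝ) t).indicator (fun _ => (1:ℝ)) s *
                        Real.exp (-(muK μ (k + 1)) * (t - s)) -
                      (Set.Ioo (0:ℝ) t).indicator (fun _ => (1:ℝ)) s' *
                        Real.exp (-(muK μ (k + 1)) * (t - s')))) ^ 2
      = lam (k + 1) ^ 2 * S k := by
    intro k
    rw [aux_sum_s3, mul_assoc]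
    simp only [hS, Psi, ff, Nat.cast_add, Nat.cast_one, add_sub_cancel_right]
  simp_rw [hterm]
  have hS0 : ∀ k, 0 ≤ S k := fun k =>
    mul_nonneg (by positivity) (Finset.sum_nonneg fun i _ => Psi_nonneg _ _ _ hd0 _)
  have hSb : ∀ k B, ∑ i ∈ Finset.range (Nat.ceil (t / d)), Psi (muK μ (k + 1)) t d i ≤ d ^ 2 * B →
      S k ≤ B := by
    intro k B h
    calc S k ≤ (d ^ 2)⁻¹ * (d ^ 2 * B) := mul_le_mul_of_nonneg_left h (by positivity)
      _ = B := by field_simp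
  have hS1 : ∀ k, S k ≤ A1 * d := by
    intro k
    apply hSb
    apply bound1 _ _ _ _ _ hd0 (sq_nonneg μ) _ ht0 ht
    unfold muK
    nlinarith [sq_nonneg (lam (k + 1) ^ 2 - μ), sq_nonneg (lam (k + 1) ^ 2 - μ / 2)]
  have hlam : ∀ k : ℕ, lam (k + 1) = ((k : ℝ) + 1) * Real.pi := by
    intro k; simp [lam]
  have hlpi : ∀ k : ℕ, Real.pi ≤ lam (k + 1) := by
    intro k
    rw [hlam]
    have : (0:ℝ) ≤ k := by positivity
    nlinarith
  have hS2 : ∀ k, S k ≤ A / lam (k + 1) ^ 4 := by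
    intro k
    have hl0 : 0 < lam (k + 1) := by linarith [hlpi k]
    set l := lam (k + 1) with hl
    rcases le_or_gt κ (k + 1) with h | h
    · have hKl : K ≤ l ^ 2 := by
        rw [hl, hlam, mul_pow, hK]
        apply mul_le_mul_of_nonneg_right _ (by positivity)
        apply pow_le_pow_left₀ (by positivity)
        exact_mod_cast h
      have hm : c * l ^ 4 ≤ muK μ (k + 1) := by
        unfold muK
        rw [← hl]
        have : c * l ^ 2 ≤ l ^ 2 - μ := by
          have e : c * l ^ 2 = l ^ 2 - μ * (l ^ 2 / K) := by
            rw [hc]; field_simp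
          have e2 : 1 ≤ l ^ 2 / K := (one_le_div hK0).2 hKl
          rw [e]; nlinarith
        calc c * l ^ 4 = l ^ 2 * (c * l ^ 2) := by ring
          _ ≤ _ := mul_le_mul_of_nonneg_left this (by positivity)
      have hcl : 0 < c * l ^ 4 := by positivity
      have := hSb k _ (bound2 _ t d hd0 (lt_of_lt_of_le hcl hm) ht0)
      calc S k ≤ _ := this
        _ ≤ 2 / (c * l ^ 4) := div_le_div_of_nonneg_left (by norm_num) hcl hm
        _ = (2 / c) / l ^ 4 := by field_simp
        _ ≤ A / l ^ 4 := by
          apply div_le_div_of_nonneg_right _ (by positivity)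
          have : 0 ≤ A1 * T * K ^ 2 := by positivity
          linarith
    · have hKl : l ^ 2 ≤ K := by
        rw [hl, hlam, mul_pow, hK]
        apply mul_le_mul_of_nonneg_right _ (by positivity)
        apply pow_le_pow_left₀ (by positivity)
        exact_mod_cast h.le
      have hKl4 : l ^ 4 ≤ K ^ 2 := by
        calc l ^ 4 = (l ^ 2) ^ 2 := by ring
          _ ≤ _ := pow_le_pow_left₀ (by positivity) hKl 2
      rw [le_div_iff₀ (by positivity)]
      calc S k * l ^ 4 ≤ (A1 * T) * K ^ 2 := by
            apply mul_le_mul _ hKl4 (by positivity) (by positivity)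
            exact (hS1 k).trans (mul_le_mul_of_nonneg_left hdT hA10.le)
        _ ≤ A := by
          have : 0 < 2 / c := by positivity
          linarith
  have hS1' : ∀ k, S k ≤ A * x ^ 4 := by
    intro k
    rw [hx4]
    refine (hS1 k).trans (mul_le_mul_of_nonneg_right ?_ hd0.le)
    have : 0 < 2 / c := by positivity
    have : 0 ≤ A1 * T * K ^ 2 := by positivity
    linarith
  set φ : ℕ → ℝ := fun k => x * (k * Real.pi) / (1 + x * (k * Real.pi)) with hφ
  have hstep : ∀ k, lam (k + 1) ^ 2 * S k ≤ 4 * A * x * (φ (k + 1) - φ k) := by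
    intro k
    have := aux_tel x (lam (k + 1)) A (S k) hx0 (hlpi k) hA0.le (hS1' k) (hS2 k)
    have e : lam (k + 1) - Real.pi = k * Real.pi := by rw [hlam]; ring
    rw [e, hlam] at this
    rw [hlam]
    simpa [hφ] using this
  have hfin : ∑' k, lam (k + 1) ^ 2 * S k ≤ 4 * A * x := by
    apply Real.tsum_le_of_sum_range_le
    · intro k
      exact mul_nonneg (sq_nonneg _) (hS0 k)
    · intro n
      refine (Finset.sum_le_sum fun k _ => hstep k).trans ?_
      rw [← Finset.mul_sum, Finset.sum_range_sub]
      have h0 : φ 0 = 0 := by simp [hφ]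
      have h1 : φ n ≤ 1 := by
        simp only [hφ]
        rw [div_le_one (by positivity)]
        linarith
      rw [h0, sub_zero]
      exact mul_le_of_le_one_right (by positivity) h1
  refine hfin.trans ?_
  have h3 : 0 ≤ d ^ ((3:ℝ)/4) := by positivity
  have h4 : 0 ≤ 4 * A * x * d ^ ((3:ℝ)/4) := by positivity
  nlinarith
end

section
/- Let a > 0, Δt > 0, b ≥ 0 and t ∈ (b, b+Δt]. Then ∫_b^{b+Δt} ( ∫_b^{b+Δt} [ 𝟙_{s < t} e^{-a(t−s)} − 𝟙_{s' < t} e^{-a(t−s')} ] ds' )² ds ≤ 6 Δt² (1 − e^{-2aΔt}) / a. -/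
/-- Let `a > 0`, `Δt > 0`, `b ≥ 0` and `t ∈ (b, b+Δt]`. Then
`∫_b^{b+Δt} (∫_b^{b+Δt} [𝟙_{s<t} e^{-a(t−s)} − 𝟙_{s'<t} e^{-a(t−s')}] ds')² ds
  ≤ 6 Δt² (1 − e^{-2aΔt})/a`. -/
theorem stmt_4 (a Δt b t : ℝ) (ha : 0 < a) (hΔt : 0 < Δt) (hb : 0 ≤ b)
    (ht₁ : b < t) (ht₂ : t ≤ b + Δt) :
    ∫ s in b..(b + Δt),
        (∫ s' in b..(b + Δt),
            ((if s < t then Real.exp (-a * (t - s)) else 0) -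
              (if s' < t then Real.exp (-a * (t - s')) else 0))) ^ 2
      ≤ 6 * Δt ^ 2 * (1 - Real.exp (-2 * a * Δt)) / a := by
  set f : ℝ → ℝ := fun s => if s < t then Real.exp (-a * (t - s)) else 0 with hf
  have hmeas : Measurable f := by
    apply Measurable.ite measurableSet_Iio
    · fun_prop
    · fun_prop
  have hf0 : ∀ s, 0 ≤ f s := by
    intro s
    simp only [hf]
    split_ifs
    · positivity
    · exact le_rfl
  have hf1 : ∀ s, f s ≤ 1 := by
    intro s
    simp only [hf]
    split_ifs with h
    · rw [Real.exp_le_one_iff]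
      nlinarith
    · exact zero_le_one
  have hint : ∀ x y : ℝ, IntervalIntegrable f MeasureTheory.volume x y := by
    intro x y
    refine (intervalIntegrable_const (c := (1:ℝ))).mono_fun hmeas.aestronglyMeasurable ?_
    refine Filter.Eventually.of_forall fun s => ?_
    simp only [Real.norm_eq_abs, abs_one]
    rw [abs_of_nonneg (hf0 s)]
    exact hf1 s
  have hint2 : ∀ x y : ℝ, IntervalIntegrable (fun s => f s ^ 2) MeasureTheory.volume x y := by
    intro x y
    refine (intervalIntegrable_const (c := (1:ℝ))).mono_fun
      (hmeas.pow_const 2).aestronglyMeasurable ?_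
    refine Filter.Eventually.of_forall fun s => ?_
    simp only [Real.norm_eq_abs, abs_one]
    rw [abs_of_nonneg (sq_nonneg _)]
    exact pow_le_one₀ (hf0 s) (hf1 s)
  set I : ℝ := ∫ s in b..(b + Δt), f s with hI
  have hinner : ∀ s, (∫ s' in b..(b + Δt), (f s - f s')) = Δt * f s - I := by
    intro s
    rw [intervalIntegral.integral_sub intervalIntegrable_const (hint _ _)]
    simp [hI]
  have hsq : (∫ s in b..(b + Δt), (∫ s' in b..(b + Δt), (f s - f s')) ^ 2)
      = Δt ^ 2 * (∫ s in b..(b + Δt), f s ^ 2) - Δt * I ^ 2 := by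
    have e : ∀ s, (∫ s' in b..(b + Δt), (f s - f s')) ^ 2
        = (Δt ^ 2 * f s ^ 2 - 2 * Δt * I * f s) + I ^ 2 := by
      intro s
      rw [hinner]; ring
    simp_rw [e]
    rw [intervalIntegral.integral_add
      (((hint2 _ _).const_mul _).sub ((hint _ _).const_mul _)) intervalIntegrable_const,
      intervalIntegral.integral_sub ((hint2 _ _).const_mul _) ((hint _ _).const_mul _),
      intervalIntegral.integral_const_mul, intervalIntegral.integral_const_mul,
      intervalIntegral.integral_const, ← hI, smul_eq_mul]
    ring
  have hb2 : (∫ s in b..(b + Δt), f s ^ 2) ≤ (1 - Real.exp (-2 * a * Δt)) / (2 * a) := by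
    rw [← intervalIntegral.integral_add_adjacent_intervals (hint2 b t) (hint2 t (b + Δt))]
    have h2 : (∫ s in t..(b + Δt), f s ^ 2) = 0 := by
      have : (∫ s in t..(b + Δt), f s ^ 2) = ∫ s in t..(b + Δt), (0:ℝ) := by
        apply intervalIntegral.integral_congr
        intro s hs
        rw [Set.uIcc_of_le ht₂] at hs
        simp [hf, not_lt.mpr hs.1]
      rw [this]; simp
    have hd : (∫ s in b..t, Real.exp (-2 * a * (t - s)))
        = (1 - Real.exp (-2 * a * (t - b))) / (2 * a) := by
      rw [intervalIntegral.integral_eq_sub_of_hasDerivAt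
        (f := fun s => Real.exp (-2 * a * (t - s)) / (2 * a))]
      · simp; ring
      · intro s _
        have h := ((((hasDerivAt_id s).const_sub t).const_mul (-2 * a)).exp).div_const (2 * a)
        refine HasDerivAt.congr_deriv h ?_
        simp only [id]
        field_simp
      · exact Continuous.intervalIntegrable (by fun_prop) _ _
    have h1 : (∫ s in b..t, f s ^ 2) ≤ ∫ s in b..t, Real.exp (-2 * a * (t - s)) := by
      apply intervalIntegral.integral_mono_on ht₁.le (hint2 _ _)
        (Continuous.intervalIntegrable (by fun_prop) _ _)
      intro s _
      simp only [hf]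
      split_ifs
      · rw [← Real.exp_nat_mul]
        apply le_of_eq
        congr 1
        push_cast
        ring
      · simp; positivity
    have h3 : (1 - Real.exp (-2 * a * (t - b))) / (2 * a)
        ≤ (1 - Real.exp (-2 * a * Δt)) / (2 * a) := by
      have : Real.exp (-2 * a * Δt) ≤ Real.exp (-2 * a * (t - b)) := by
        apply Real.exp_le_exp.mpr
        nlinarith
      gcongr
    linarith
  have hE : 0 ≤ (1 - Real.exp (-2 * a * Δt)) / (2 * a) := by
    apply div_nonneg _ (by positivity)
    have : Real.exp (-2 * a * Δt) ≤ 1 := by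
      rw [Real.exp_le_one_iff]
      nlinarith [mul_pos ha hΔt]
    linarith
  have hfin : 6 * Δt ^ 2 * (1 - Real.exp (-2 * a * Δt)) / a
      = 12 * (Δt ^ 2 * ((1 - Real.exp (-2 * a * Δt)) / (2 * a))) := by
    field_simp
    ring
  have hm := mul_le_mul_of_nonneg_left hb2 (sq_nonneg Δt)
  have hm0 := mul_nonneg (sq_nonneg Δt) hE
  have hm1 := mul_nonneg hΔt.le (sq_nonneg I)
  change (∫ s in b..(b + Δt), (∫ s' in b..(b + Δt), (f s - f s')) ^ 2) ≤ _
  rw [hsq, hfin]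
  linarith
end

section
/- Let a > 0, Δt > 0, N ∈ ℕ with N ≥ 2, set t_j := jΔt for j ≥ 0, and let t ≥ t_{N−1}. For n = 1,…,N−1 define Ψ_n := ∫_{t_{n−1}}^{t_n} ( ∫_{t_{n−1}}^{t_n} [ e^{-a(t−s)} − e^{-a(t−s')} ] ds' )² ds. Then ∑_{n=1}^{N−1} Ψ_n ≤ 2 Δt² (1 − e^{-aΔt})² / a. -/
lemma aux_scalar (x : ℝ) (hx : 0 < x) :
    x * (1 + Real.exp (-x)) * (1 - 4 * (1 - Real.exp (-x)) ^ 2) ≤ 2 * (1 - Real.exp (-x)) := by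
  have hs : x / 2 ≤ Real.sinh (x / 2) := Real.self_le_sinh_iff.2 (by positivity)
  rw [Real.sinh_eq] at hs
  have hq : Real.exp (-x) = Real.exp (-(x / 2)) ^ 2 := by
    rw [← Real.exp_nat_mul]; congr 1; push_cast; ring
  have hr0 : 0 < Real.exp (-(x / 2)) := Real.exp_pos _
  have hrr : Real.exp (x / 2) * Real.exp (-(x / 2)) = 1 := by
    rw [← Real.exp_add]; simp
  rw [hq]
  generalize Real.exp (-(x / 2)) = r at *
  generalize Real.exp (x / 2) = w at *
  have h1 : x * r ≤ 1 - r ^ 2 := by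
    have := mul_le_mul_of_nonneg_right hs hr0.le
    nlinarith
  have h2 : (1 + r ^ 2) * (1 - 4 * (1 - r ^ 2) ^ 2) ≤ 2 * r := by
    have h3 : 1 ≤ 4 * (1 + r ^ 2) * (1 + r) ^ 2 := by nlinarith [sq_nonneg r, mul_pos hr0 hr0, pow_pos hr0 3, pow_pos hr0 4]
    have := mul_le_mul_of_nonneg_left h3 (sq_nonneg (1 - r))
    nlinarith
  have := mul_le_mul_of_nonneg_left h2 hx.le
  nlinarith

lemma aux_psi (a h t u v : ℝ) (ha : 0 < a) (hh : 0 < h) (huv : v - u = h) :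
    ∫ s in u..v, (∫ s' in u..v,
        (Real.exp (-a * (t - s)) - Real.exp (-a * (t - s')))) ^ 2
      ≤ 2 * h ^ 2 * (1 - Real.exp (-a * h)) ^ 2 / a *
        (Real.exp (-a * (t - v)) ^ 2 - Real.exp (-a * (t - u)) ^ 2) := by
  have hd : ∀ s, HasDerivAt (fun s => Real.exp (-a * (t - s))) (a * Real.exp (-a * (t - s))) s := by
    intro s
    have := (((hasDerivAt_id s).const_sub t).const_mul (-a)).exp
    refine this.congr_deriv ?_
    change Real.exp (-a * (t - s)) * (-a * -1) = _
    ring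
  set f : ℝ → ℝ := fun s => Real.exp (-a * (t - s)) with hf
  replace hd : ∀ s, HasDerivAt f (a * f s) s := hd
  have hfc : Continuous f := by rw [hf]; fun_prop
  have hI : ∫ s in u..v, f s = (f v - f u) / a := by
    rw [intervalIntegral.integral_eq_sub_of_hasDerivAt (f := fun s => f s / a)]
    · ring
    · intro s _
      refine ((hd s).div_const a).congr_deriv ?_
      rw [mul_div_cancel_left₀ _ ha.ne']
    · exact hfc.intervalIntegrable _ _
  have hin : ∀ s, ∫ s' in u..v, (Real.exp (-a * (t - s)) - Real.exp (-a * (t - s')))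
      = h * f s - (f v - f u) / a := by
    intro s
    rw [← hI, intervalIntegral.integral_sub (by simp) (hfc.intervalIntegrable _ _)]
    simp [huv, hf]
  simp_rw [hin]
  generalize hIg : (f v - f u) / a = I
  have hout : ∫ s in u..v, (h * f s - I) ^ 2
      = (h ^ 2 * f v ^ 2 / (2 * a) - 2 * h * I * f v / a + I ^ 2 * v)
        - (h ^ 2 * f u ^ 2 / (2 * a) - 2 * h * I * f u / a + I ^ 2 * u) := by
    rw [intervalIntegral.integral_eq_sub_of_hasDerivAt
      (f := fun s => h ^ 2 * f s ^ 2 / (2 * a) - 2 * h * I * f s / a + I ^ 2 * s)]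
    · intro s _
      have := (((((hd s).pow 2).const_mul (h ^ 2)).div_const (2 * a)).sub
        (((hd s).const_mul (2 * h * I)).div_const a)).add ((hasDerivAt_id s).const_mul (I ^ 2))
      refine this.congr_deriv ?_
      field_simp
      simp
      ring
    · apply Continuous.intervalIntegrable; fun_prop
  rw [hout]
  have hu : f u = Real.exp (-a * h) * f v := by
    simp only [hf]; rw [← Real.exp_add]; congr 1; rw [← huv]; ring
  have key := aux_scalar (a * h) (by positivity)
  rw [← neg_mul] at key
  have hq1 : Real.exp (-a * h) ≤ 1 := Real.exp_le_one_iff.2 (by nlinarith [mul_pos ha hh])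
  change _ ≤ 2 * h ^ 2 * (1 - Real.exp (-a * h)) ^ 2 / a * (f v ^ 2 - f u ^ 2)
  rw [hu] at hIg ⊢
  generalize Real.exp (-a * h) = q at *
  generalize f v = E at *
  have hv : v = u + h := by linarith
  subst hIg hv
  rw [← sub_nonneg]
  have : 0 ≤ (2 * (1 - q) - a * h * (1 + q) * (1 - 4 * (1 - q) ^ 2)) * (h * E ^ 2 * (1 - q) / (2 * a ^ 2)) := by
    apply mul_nonneg (by linarith)
    have : 0 ≤ 1 - q := by linarith
    positivity
  convert this using 1
  field_simp
  ring

/-- Let `a > 0`, `Δt > 0`, `N ≥ 2`, `t_j = jΔt`, and `t ≥ t_{N−1}`. With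
`Ψ_n = ∫_{t_{n−1}}^{t_n} (∫_{t_{n−1}}^{t_n} [e^{-a(t−s)} − e^{-a(t−s')}] ds')² ds`
for `n = 1,…,N−1`, one has `∑_{n=1}^{N−1} Ψ_n ≤ 2 Δt² (1 − e^{-aΔt})²/a`. -/
theorem stmt_5 (a Δt : ℝ) (N : ℕ) (ha : 0 < a) (hΔt : 0 < Δt) (hN : 2 ≤ N)
    (t : ℝ) (ht : ((N : ℝ) - 1) * Δt ≤ t) :
    ∑ n ∈ Finset.Icc 1 (N - 1),
        ∫ s in (((n : ℝ) - 1) * Δt)..((n : ℝ) * Δt),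
          (∫ s' in (((n : ℝ) - 1) * Δt)..((n : ℝ) * Δt),
              (Real.exp (-a * (t - s)) - Real.exp (-a * (t - s')))) ^ 2
      ≤ 2 * Δt ^ 2 * (1 - Real.exp (-a * Δt)) ^ 2 / a := by
  obtain ⟨M, rfl⟩ : ∃ M, N = M + 1 := ⟨N - 1, by omega⟩
  have tele : ∀ K : ℕ, ∑ n ∈ Finset.Icc 1 K,
        ∫ s in (((n : ℝ) - 1) * Δt)..((n : ℝ) * Δt),
          (∫ s' in (((n : ℝ) - 1) * Δt)..((n : ℝ) * Δt),
              (Real.exp (-a * (t - s)) - Real.exp (-a * (t - s')))) ^ 2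
      ≤ 2 * Δt ^ 2 * (1 - Real.exp (-a * Δt)) ^ 2 / a *
        (Real.exp (-a * (t - K * Δt)) ^ 2 - Real.exp (-a * t) ^ 2) := by
    intro K
    induction K with
    | zero => simp
    | succ K ih =>
      rw [Finset.sum_Icc_succ_top (by omega)]
      have := aux_psi a Δt t ((((K + 1 : ℕ) : ℝ) - 1) * Δt) (((K + 1 : ℕ) : ℝ) * Δt) ha hΔt (by ring)
      refine (add_le_add ih this).trans (le_of_eq ?_)
      have e : (((K + 1 : ℕ) : ℝ) - 1) = K := by push_cast; ring
      rw [e]; ring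
  rw [Nat.add_sub_cancel]
  refine (tele M).trans (mul_le_of_le_one_right (by positivity) ?_)
  have h1 : Real.exp (-a * (t - M * Δt)) ≤ 1 := by
    apply Real.exp_le_one_iff.2
    push_cast at ht
    have : 0 ≤ t - M * Δt := by linarith
    nlinarith [mul_nonneg ha.le this]
  nlinarith [Real.exp_pos (-a * (t - M * Δt)), sq_nonneg (Real.exp (-a * t))]
end

section
/- Assume μ ≥ 0, let ℓ ∈ ℕ₀, p ∈ ℝ, t ≥ 0, and let (c_k)_{k∈ℕ} be a sequence of reals. Then, as an inequality of (possibly infinite) sums of nonnegative terms, ∑_{k=1}^∞ λ_k^{2p} (μ_k + μ²)^{2ℓ} e^{-2(μ_k+μ²)t} c_k² ≤ (1 + μ/π² + μ²/π⁴)^{2ℓ} · ∑_{k=1}^∞ λ_k^{2(p+4ℓ)} e^{-λ_k⁴ t} c_k². -/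
/-- Assume `μ ≥ 0`, let `ℓ ∈ ℕ₀`, `p ∈ ℝ`, `t ≥ 0`, and let `(c_k)` be a real sequence. Then,
as an inequality of (possibly infinite) sums of nonnegative terms,
`∑_k λ_k^{2p} (μ_k + μ²)^{2ℓ} e^{-2(μ_k+μ²)t} c_k²
  ≤ (1 + μ/π² + μ²/π⁴)^{2ℓ} ∑_k λ_k^{2(p+4ℓ)} e^{-λ_k⁴ t} c_k²`. -/
theorem stmt_6 (μ : ℝ) (hμ : 0 ≤ μ) (ℓ : ℕ) (p t : ℝ) (ht : 0 ≤ t) (c : ℕ → ℝ) :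
    (∑' k : ℕ, ENNReal.ofReal
        (lam (k + 1) ^ (2 * p) * (muK μ (k + 1) + μ ^ 2) ^ (2 * ℓ) *
          Real.exp (-(2 * (muK μ (k + 1) + μ ^ 2)) * t) * (c (k + 1)) ^ 2))
      ≤ ENNReal.ofReal ((1 + μ / Real.pi ^ 2 + μ ^ 2 / Real.pi ^ 4) ^ (2 * ℓ)) *
        ∑' k : ℕ, ENNReal.ofReal
          (lam (k + 1) ^ (2 * (p + 4 * (ℓ : ℝ))) *
            Real.exp (-(lam (k + 1) ^ 4) * t) * (c (k + 1)) ^ 2) := by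
  rw [← ENNReal.tsum_mul_left]
  refine ENNReal.tsum_le_tsum fun k => ?_
  have hpi := Real.pi_pos
  have hB : 0 ≤ 1 + μ / Real.pi ^ 2 + μ ^ 2 / Real.pi ^ 4 := by positivity
  rw [← ENNReal.ofReal_mul (pow_nonneg hB _)]
  apply ENNReal.ofReal_le_ofReal
  have hl : Real.pi ≤ lam (k + 1) := by
    unfold lam
    push_cast
    have : (0 : ℝ) ≤ k := Nat.cast_nonneg k
    nlinarith
  unfold muK
  generalize lam (k + 1) = x at hl ⊢
  have hx : 0 < x := lt_of_lt_of_le hpi hl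
  have hA0 : 0 ≤ x ^ 2 * (x ^ 2 - μ) + μ ^ 2 := by
    nlinarith [sq_nonneg (x ^ 2 - μ), sq_nonneg (x ^ 2), sq_nonneg μ]
  have hA : x ^ 2 * (x ^ 2 - μ) + μ ^ 2 ≤
      (1 + μ / Real.pi ^ 2 + μ ^ 2 / Real.pi ^ 4) * x ^ 4 := by
    have h4 : Real.pi ^ 4 ≤ x ^ 4 := pow_le_pow_left₀ hpi.le hl 4
    have h1 : μ ^ 2 ≤ μ ^ 2 / Real.pi ^ 4 * x ^ 4 := by
      rw [div_mul_eq_mul_div, le_div_iff₀ (by positivity)]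
      exact mul_le_mul_of_nonneg_left h4 (sq_nonneg μ)
    have h2 : 0 ≤ μ / Real.pi ^ 2 * x ^ 4 := by positivity
    have h3 : 0 ≤ x ^ 2 * μ := by positivity
    nlinarith
  have hE : Real.exp (-(2 * (x ^ 2 * (x ^ 2 - μ) + μ ^ 2)) * t) ≤ Real.exp (-(x ^ 4) * t) := by
    apply Real.exp_le_exp.mpr
    apply mul_le_mul_of_nonneg_right _ ht
    nlinarith [sq_nonneg (x ^ 2 - μ), sq_nonneg μ]
  have hP : x ^ (2 * (p + 4 * (ℓ : ℝ))) = x ^ (2 * p) * (x ^ 4) ^ (2 * ℓ) := by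
    rw [← pow_mul, ← Real.rpow_natCast, ← Real.rpow_add hx]
    congr 1
    push_cast
    ring
  have hpow := pow_le_pow_left₀ hA0 hA (2 * ℓ)
  rw [mul_pow] at hpow
  have hxp : 0 ≤ x ^ (2 * p) := Real.rpow_nonneg hx.le _
  rw [hP]
  calc _ ≤ x ^ (2 * p) * ((1 + μ / Real.pi ^ 2 + μ ^ 2 / Real.pi ^ 4) ^ (2 * ℓ) *
        (x ^ 4) ^ (2 * ℓ)) * Real.exp (-(x ^ 4) * t) * (c (k + 1)) ^ 2 := by
        gcongr
    _ = _ := by ring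
end

section
/- Assume μ ≥ 0, let ℓ ∈ ℕ₀, p ∈ ℝ, β ≥ 0, 0 ≤ t_a < t_b, and let (c_k)_{k∈ℕ} be a sequence of reals. Then ∫_{t_a}^{t_b} (τ − t_a)^β · ( ∑_{k=1}^∞ λ_k^{2p} (μ_k + μ²)^{2ℓ} e^{-2(μ_k+μ²)τ} c_k² ) dτ ≤ (1 + μ/π² + μ²/π⁴)^{2ℓ} · ( ∫_0^∞ x^β e^{-x} dx ) · ∑_{k=1}^∞ λ_k^{2(p+4ℓ−2β−2)} c_k², where both sides may equal +∞. -/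
open MeasureTheory

lemma aux_int_s7 (β r ta tb : ℝ) (hβ : 0 ≤ β) (hr : 0 < r) :
    (∫⁻ τ in Set.Ioc ta tb, ENNReal.ofReal ((τ - ta) ^ β * Real.exp (-(r * (τ - ta)))))
      ≤ ENNReal.ofReal ((1 / r) ^ (β + 1) * Real.Gamma (β + 1)) := by
  have hI : ∫ t in Set.Ioi (0:ℝ), t ^ β * Real.exp (-(r * t))
      = (1 / r) ^ (β + 1) * Real.Gamma (β + 1) := by
    have := Real.integral_rpow_mul_exp_neg_mul_Ioi (a := β + 1) (r := r) (by linarith) hr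
    simpa using this
  have hpos : 0 < (1 / r) ^ (β + 1) * Real.Gamma (β + 1) := by
    have := Real.Gamma_pos_of_pos (s := β + 1) (by linarith)
    positivity
  have hint : Integrable (fun t : ℝ => t ^ β * Real.exp (-(r * t)))
      (volume.restrict (Set.Ioi (0:ℝ))) := by
    apply Integrable.of_integral_ne_zero
    rw [hI]; exact hpos.ne'
  calc (∫⁻ τ in Set.Ioc ta tb, ENNReal.ofReal ((τ - ta) ^ β * Real.exp (-(r * (τ - ta)))))
      ≤ ∫⁻ τ in (fun x => x - ta) ⁻¹' (Set.Ioi 0),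
          ENNReal.ofReal ((τ - ta) ^ β * Real.exp (-(r * (τ - ta)))) := by
        apply lintegral_mono_set
        intro x hx
        simp only [Set.mem_preimage, Set.mem_Ioi]
        linarith [hx.1]
    _ = ∫⁻ t in Set.Ioi (0:ℝ), ENNReal.ofReal (t ^ β * Real.exp (-(r * t))) :=
        (measurePreserving_sub_right volume ta).setLIntegral_comp_preimage
          measurableSet_Ioi (f := fun t => ENNReal.ofReal (t ^ β * Real.exp (-(r * t))))
          (by fun_prop)
    _ = _ := by
        rw [← hI, ofReal_integral_eq_lintegral_ofReal hint]
        filter_upwards [ae_restrict_mem measurableSet_Ioi] with t ht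
        have : (0:ℝ) < t := ht
        simp only [Pi.zero_apply]
        positivity

lemma aux_lam (k : ℕ) : Real.pi ≤ lam (k + 1) := by
  unfold lam
  push_cast
  nlinarith [Real.pi_pos, (Nat.cast_nonneg k : (0:ℝ) ≤ k)]

lemma aux_term_s7 (μ : ℝ) (hμ : 0 ≤ μ) (ℓ : ℕ) (p β : ℝ) (ta τ : ℝ) (hta : 0 ≤ ta) (hτ : ta < τ)
    (x c : ℝ) (hx : Real.pi ≤ x) :
    (τ - ta) ^ β * (x ^ (2 * p) * (x ^ 2 * (x ^ 2 - μ) + μ ^ 2) ^ (2 * ℓ) *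
              Real.exp (-(2 * (x ^ 2 * (x ^ 2 - μ) + μ ^ 2)) * τ) * c ^ 2)
    ≤ ((1 + μ / Real.pi ^ 2 + μ ^ 2 / Real.pi ^ 4) ^ (2 * ℓ) *
        (x ^ (2 * p) * (x ^ 4) ^ (2 * ℓ) * c ^ 2)) *
        ((τ - ta) ^ β * Real.exp (-(x ^ 4 * (τ - ta)))) := by
  have hpi := Real.pi_pos
  have hx0 : 0 < x := by linarith
  have hd : 0 < τ - ta := by linarith
  have ha0 : 0 ≤ x ^ 2 * (x ^ 2 - μ) + μ ^ 2 := by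
    nlinarith [sq_nonneg (x ^ 2 - μ), sq_nonneg μ, sq_nonneg (x ^ 2)]
  have ha1 : x ^ 4 ≤ 2 * (x ^ 2 * (x ^ 2 - μ) + μ ^ 2) := by
    nlinarith [sq_nonneg (x ^ 2 - μ), sq_nonneg μ]
  have ha2 : x ^ 2 * (x ^ 2 - μ) + μ ^ 2
      ≤ (1 + μ / Real.pi ^ 2 + μ ^ 2 / Real.pi ^ 4) * x ^ 4 := by
    have h4 : Real.pi ^ 4 ≤ x ^ 4 := by gcongr
    have h1 : μ ^ 2 ≤ μ ^ 2 / Real.pi ^ 4 * x ^ 4 := by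
      rw [div_mul_eq_mul_div, le_div_iff₀ (by positivity)]
      gcongr
    have h2 : 0 ≤ μ / Real.pi ^ 2 * x ^ 4 := by positivity
    have h3 : 0 ≤ x ^ 2 * μ := by positivity
    nlinarith
  have hp : (x ^ 2 * (x ^ 2 - μ) + μ ^ 2) ^ (2 * ℓ)
      ≤ (1 + μ / Real.pi ^ 2 + μ ^ 2 / Real.pi ^ 4) ^ (2 * ℓ) * (x ^ 4) ^ (2 * ℓ) := by
    rw [← mul_pow]
    gcongr
  have he : Real.exp (-(2 * (x ^ 2 * (x ^ 2 - μ) + μ ^ 2)) * τ)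
      ≤ Real.exp (-(x ^ 4 * (τ - ta))) := by
    apply Real.exp_le_exp.mpr
    have h1 := mul_le_mul_of_nonneg_right ha1 (by linarith : 0 ≤ τ)
    have h2 : 0 ≤ x ^ 4 * ta := by positivity
    nlinarith
  calc _ ≤ (τ - ta) ^ β * (x ^ (2 * p) * ((1 + μ / Real.pi ^ 2 + μ ^ 2 / Real.pi ^ 4) ^ (2 * ℓ)
              * (x ^ 4) ^ (2 * ℓ)) * Real.exp (-(x ^ 4 * (τ - ta))) * c ^ 2) := by gcongr
    _ = _ := by ring

/-- Assume `μ ≥ 0`, let `ℓ ∈ ℕ₀`, `p ∈ ℝ`, `β ≥ 0`, `0 ≤ t_a < t_b`, and let `(c_k)` be a real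
sequence. Then `∫_{t_a}^{t_b} (τ−t_a)^β ∑_k λ_k^{2p} (μ_k+μ²)^{2ℓ} e^{-2(μ_k+μ²)τ} c_k² dτ
  ≤ (1 + μ/π² + μ²/π⁴)^{2ℓ} (∫_0^∞ x^β e^{-x} dx) ∑_k λ_k^{2(p+4ℓ−2β−2)} c_k²`,
where both sides may equal `+∞`. -/
theorem stmt_7 (μ : ℝ) (hμ : 0 ≤ μ) (ℓ : ℕ) (p β : ℝ) (hβ : 0 ≤ β)
    (ta tb : ℝ) (hta : 0 ≤ ta) (htab : ta < tb) (c : ℕ → ℝ) :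
    (∫⁻ τ in Set.Ioc ta tb,
        ENNReal.ofReal ((τ - ta) ^ β) *
          ∑' k : ℕ, ENNReal.ofReal
            (lam (k + 1) ^ (2 * p) * (muK μ (k + 1) + μ ^ 2) ^ (2 * ℓ) *
              Real.exp (-(2 * (muK μ (k + 1) + μ ^ 2)) * τ) * (c (k + 1)) ^ 2))
      ≤ ENNReal.ofReal ((1 + μ / Real.pi ^ 2 + μ ^ 2 / Real.pi ^ 4) ^ (2 * ℓ)) *
        ENNReal.ofReal (∫ x in Set.Ioi (0:ℝ), x ^ β * Real.exp (-x)) *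
        ∑' k : ℕ, ENNReal.ofReal
          (lam (k + 1) ^ (2 * (p + 4 * (ℓ : ℝ) - 2 * β - 2)) * (c (k + 1)) ^ 2) := by
  have hG : ∫ x in Set.Ioi (0:ℝ), x ^ β * Real.exp (-x) = Real.Gamma (β + 1) := by
    have := Real.integral_rpow_mul_exp_neg_mul_Ioi (a := β + 1) (r := 1) (by linarith) one_pos
    simpa using this
  have hGp : 0 < Real.Gamma (β + 1) := Real.Gamma_pos_of_pos (by linarith)
  rw [hG]
  simp_rw [← ENNReal.tsum_mul_left]
  rw [lintegral_tsum (fun k => by fun_prop)]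
  refine ENNReal.tsum_le_tsum fun k => ?_
  have hx := aux_lam k
  unfold muK
  generalize lam (k + 1) = x at hx ⊢
  generalize c (k + 1) = c
  have hpi := Real.pi_pos
  have hx0 : 0 < x := by linarith
  calc _ ≤ ∫⁻ τ in Set.Ioc ta tb,
        ENNReal.ofReal ((1 + μ / Real.pi ^ 2 + μ ^ 2 / Real.pi ^ 4) ^ (2 * ℓ) *
        (x ^ (2 * p) * (x ^ 4) ^ (2 * ℓ) * c ^ 2)) *
        ENNReal.ofReal ((τ - ta) ^ β * Real.exp (-(x ^ 4 * (τ - ta)))) := by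
        refine setLIntegral_mono' measurableSet_Ioc fun τ hτ => ?_
        have hd : 0 < τ - ta := by linarith [hτ.1]
        rw [← ENNReal.ofReal_mul (by positivity), ← ENNReal.ofReal_mul (by positivity)]
        exact ENNReal.ofReal_le_ofReal (aux_term_s7 μ hμ ℓ p β ta τ hta hτ.1 x c hx)
    _ ≤ ENNReal.ofReal ((1 + μ / Real.pi ^ 2 + μ ^ 2 / Real.pi ^ 4) ^ (2 * ℓ) *
        (x ^ (2 * p) * (x ^ 4) ^ (2 * ℓ) * c ^ 2)) *
        ENNReal.ofReal ((1 / x ^ 4) ^ (β + 1) * Real.Gamma (β + 1)) := by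
        rw [lintegral_const_mul' _ _ ENNReal.ofReal_ne_top]
        gcongr
        exact aux_int_s7 β (x ^ 4) ta tb hβ (by positivity)
    _ = _ := by
        rw [← ENNReal.ofReal_mul (by positivity), ← ENNReal.ofReal_mul (by positivity),
          ← ENNReal.ofReal_mul (by positivity)]
        congr 1
        have e1 : (1 / x ^ 4) ^ (β + 1) = x ^ (-4 * (β + 1)) := by
          rw [Real.rpow_mul hx0.le]
          congr 1
          rw [Real.rpow_neg hx0.le, one_div]
          norm_cast
        have e2 : (x ^ 4) ^ (2 * ℓ) = x ^ (8 * (ℓ : ℝ)) := by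
          rw [← pow_mul, ← Real.rpow_natCast]
          congr 1
          push_cast
          ring
        have e3 : x ^ (2 * (p + 4 * (ℓ : ℝ) - 2 * β - 2))
            = x ^ (2 * p) * x ^ (8 * (ℓ : ℝ)) * x ^ (-4 * (β + 1)) := by
          rw [← Real.rpow_add hx0, ← Real.rpow_add hx0]
          congr 1
          ring
        rw [e1, e2, e3]
        ring
end

section
/- Assume that κ = 1, or that κ ≥ 2 and Δτ μ² < 1/4. Then there exists a constant C > 0, independent of Δτ and of the sequence (c_k), such that for every θ ∈ [0,1] and every real sequence (c_k)_{k∈ℕ} with ∑_k λ_k⁴ c_k² < ∞: ( ∑_{m=1}^M Δτ · ∑_{k=1}^∞ ( (1 + Δτ μ_k)^{-m} − e^{-μ_k m Δτ} )² c_k² )^{1/2} ≤ C · Δτ^θ · ( ∑_{k=1}^∞ λ_k^{2(4θ−2)} c_k² )^{1/2}. -/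
lemma aux_diff (x : ℝ) (hx : 0 < 1 + x) (m : ℕ) :
    0 ≤ ((1 + x)⁻¹) ^ m - Real.exp (-x) ^ m ∧
    ((1 + x)⁻¹) ^ m - Real.exp (-x) ^ m ≤ m * ((1 + x)⁻¹) ^ m * x ^ 2 := by
  have ha : 0 < (1 + x)⁻¹ := inv_pos.mpr hx
  have hba : Real.exp (-x) ≤ (1 + x)⁻¹ := by
    rw [Real.exp_neg]
    apply inv_anti₀ hx
    linarith [Real.add_one_le_exp x]
  have hb : 0 < Real.exp (-x) := Real.exp_pos _
  have hd : (1 + x)⁻¹ - Real.exp (-x) ≤ (1 + x)⁻¹ * x ^ 2 := by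
    have h1 := Real.add_one_le_exp (-x)
    have h2 : (1 + x)⁻¹ - (1 - x) = (1 + x)⁻¹ * x ^ 2 := by
      field_simp
      ring
    linarith
  generalize (1 + x)⁻¹ = a at *
  generalize Real.exp (-x) = b at *
  refine ⟨sub_nonneg.mpr (pow_le_pow_left₀ hb.le hba m), ?_⟩
  induction m with
  | zero => simp
  | succ m ih =>
    have h1 : b ^ m ≤ a ^ m := pow_le_pow_left₀ hb.le hba m
    have h2 : a ^ (m + 1) - b ^ (m + 1) = a * (a ^ m - b ^ m) + b ^ m * (a - b) := by ring
    have h3 : a * (a ^ m - b ^ m) ≤ a * (m * a ^ m * x ^ 2) :=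
      mul_le_mul_of_nonneg_left ih ha.le
    have h4 : b ^ m * (a - b) ≤ a ^ m * (a * x ^ 2) :=
      mul_le_mul h1 hd (by linarith) (by positivity)
    rw [h2]
    push_cast
    calc _ ≤ a * (m * a ^ m * x ^ 2) + a ^ m * (a * x ^ 2) := add_le_add h3 h4
      _ = _ := by ring

lemma aux_geom (x : ℝ) (hx : 0 < x) (M : ℕ) :
    ∑ m ∈ Finset.Icc 1 M, ((1 + x)⁻¹) ^ m ≤ 1 / x := by
  have h : ∀ M : ℕ, ∑ m ∈ Finset.Icc 1 M, ((1 + x)⁻¹) ^ m = (1 - ((1 + x)⁻¹) ^ M) / x := by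
    intro M
    induction M with
    | zero => simp
    | succ M ih =>
      rw [Finset.sum_Icc_succ_top (by omega), ih, pow_succ]
      have : (1 + x) ≠ 0 := by positivity
      generalize hy : ((1 + x)⁻¹) ^ M = y
      field_simp
      ring
  rw [h]
  have : 0 ≤ ((1 + x)⁻¹) ^ M := by positivity
  gcongr
  linarith

lemma aux_pow (x : ℝ) (hx : 0 ≤ x) (m : ℕ) :
    1 + m * x + m * (m - 1) / 2 * x ^ 2 ≤ (1 + x) ^ m := by
  induction m with
  | zero => simp
  | succ m ih =>
    rw [pow_succ (1 + x) m]
    have h1 := mul_le_mul_of_nonneg_right ih (show 0 ≤ 1 + x by linarith)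
    have h2 : 0 ≤ (m : ℝ) * (m - 1) := by
      rcases m with _ | m
      · simp
      · push_cast
        ring_nf
        positivity
    have h3 : 0 ≤ (m : ℝ) * (m - 1) * x ^ 3 := by positivity
    push_cast
    nlinarith

lemma aux_pos (x : ℝ) (hx : 0 < x) (M : ℕ) :
    ∑ m ∈ Finset.Icc 1 M, (((1 + x)⁻¹) ^ m - Real.exp (-x) ^ m) ^ 2 ≤ 1 / x ∧
    ∑ m ∈ Finset.Icc 1 M, (((1 + x)⁻¹) ^ m - Real.exp (-x) ^ m) ^ 2 ≤ 4 * x := by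
  have ha1 : (1 + x)⁻¹ ≤ 1 := inv_le_one_of_one_le₀ (by linarith)
  have ha0 : 0 < (1 + x)⁻¹ := by positivity
  have hg := aux_geom x hx M
  have hA : ∑ m ∈ Finset.Icc 1 M, (((1 + x)⁻¹) ^ m - Real.exp (-x) ^ m) ^ 2 ≤ 1 / x := by
    refine le_trans (Finset.sum_le_sum fun m _ => ?_) hg
    have h0 := (aux_diff x (by linarith) m).1
    have h1 : 0 < Real.exp (-x) ^ m := by positivity
    have h2 : ((1 + x)⁻¹) ^ m ≤ 1 := pow_le_one₀ ha0.le ha1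
    nlinarith
  refine ⟨hA, ?_⟩
  rcases le_total 1 x with h | h
  · refine hA.trans ?_
    rw [div_le_iff₀ hx]
    nlinarith
  · calc _ ≤ ∑ m ∈ Finset.Icc 1 M, (4 * x ^ 2) * ((1 + x)⁻¹) ^ m := by
          refine Finset.sum_le_sum fun m _ => ?_
          obtain ⟨h0, h1⟩ := aux_diff x (by linarith) m
          have h2 := aux_pow x hx.le m
          have h3 : (m : ℝ) ^ 2 * x ^ 2 ≤ 4 * (1 + x) ^ m := by
            have : (0 : ℝ) ≤ m * x * (1 - x) := by
              have : 0 ≤ 1 - x := by linarith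
              positivity
            have : (0 : ℝ) ≤ m * x := by positivity
            nlinarith [sq_nonneg ((m : ℝ) * x)]
          have h4 : (1 + x) ^ m * ((1 + x)⁻¹) ^ m = 1 := by
            rw [← mul_pow, mul_inv_cancel₀ (by linarith), one_pow]
          have h5 := pow_le_pow_left₀ h0 h1 2
          refine h5.trans ?_
          have hP : 0 < ((1 + x)⁻¹) ^ m := by positivity
          generalize ((1 + x)⁻¹) ^ m = P at *
          generalize (1 + x) ^ m = Q at *
          calc (m * P * x ^ 2) ^ 2 = (m ^ 2 * x ^ 2) * (P ^ 2 * x ^ 2) := by ring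
            _ ≤ (4 * Q) * (P ^ 2 * x ^ 2) := by gcongr
            _ = 4 * x ^ 2 * P * (Q * P) := by ring
            _ = _ := by rw [h4]; ring
      _ ≤ (4 * x ^ 2) * (1 / x) := by
          rw [← Finset.mul_sum]
          gcongr
      _ = 4 * x := by field_simp

lemma aux_neg (x : ℝ) (hx : -(1 / 2) ≤ x) (hx0 : x ≤ 0) (M : ℕ) :
    ∑ m ∈ Finset.Icc 1 M, (((1 + x)⁻¹) ^ m - Real.exp (-x) ^ m) ^ 2 ≤
      M * (M * x ^ 2 * Real.exp (2 * (M * -x))) ^ 2 := by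
  have : ∀ m ∈ Finset.Icc 1 M, (((1 + x)⁻¹) ^ m - Real.exp (-x) ^ m) ^ 2 ≤
      (M * x ^ 2 * Real.exp (2 * (M * -x))) ^ 2 := by
    intro m hm
    have hm2 : (m : ℝ) ≤ M := by exact_mod_cast (Finset.mem_Icc.mp hm).2
    obtain ⟨h0, h1⟩ := aux_diff x (by linarith) m
    refine pow_le_pow_left₀ h0 (h1.trans ?_) 2
    have h2 : (1 + x)⁻¹ ≤ Real.exp (2 * -x) := by
      refine le_trans ?_ (Real.add_one_le_exp _)
      rw [inv_le_iff_one_le_mul₀ (by linarith)]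
      nlinarith
    have h3 : ((1 + x)⁻¹) ^ m ≤ Real.exp (2 * (M * -x)) := by
      refine (pow_le_pow_left₀ (inv_nonneg.mpr (by linarith)) h2 m).trans ?_
      rw [← Real.exp_nat_mul]
      apply Real.exp_le_exp.mpr
      nlinarith
    calc _ = m * x ^ 2 * ((1 + x)⁻¹) ^ m := by ring
      _ ≤ _ := by
        have : 0 ≤ ((1 + x)⁻¹) ^ m := pow_nonneg (inv_nonneg.mpr (by linarith)) m
        gcongr
  refine (Finset.sum_le_sum this).trans ?_
  simp

lemma aux_interp (A D p q θ : ℝ) (hA : 0 ≤ A) (hD : 0 < D) (hp : 0 < p) (hq : 0 < q)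
    (h0 : 0 ≤ θ) (h1 : θ ≤ 1) (hAp : A ≤ D * p) (hAq : A ≤ D * q) :
    A ≤ D * (p ^ (1 - θ) * q ^ θ) := by
  rcases hA.eq_or_lt with h | h
  · rw [← h]; positivity
  calc A = A ^ (1 - θ) * A ^ θ := by rw [← Real.rpow_add h]; simp
    _ ≤ (D * p) ^ (1 - θ) * (D * q) ^ θ := by
      gcongr
    _ = (D ^ (1 - θ) * D ^ θ) * (p ^ (1 - θ) * q ^ θ) := by
      rw [Real.mul_rpow hD.le hp.le, Real.mul_rpow hD.le hq.le]; ring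
    _ = _ := by rw [← Real.rpow_add hD]; simp

lemma aux_pq (h L θ : ℝ) (hh : 0 < h) (hL : 0 < L) :
    ((L ^ 4)⁻¹) ^ (1 - θ) * (h ^ 2 * L ^ 4) ^ θ = (h ^ θ) ^ 2 * L ^ (2 * (4 * θ - 2)) := by
  have e1 : (L ^ 4)⁻¹ = L ^ (-4 : ℝ) := by
    rw [Real.rpow_neg hL.le]; norm_cast
  have e2 : L ^ 4 = L ^ (4 : ℝ) := by norm_cast
  rw [Real.mul_rpow (by positivity) (by positivity), e1, e2, ← Real.rpow_mul hL.le,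
    ← Real.rpow_mul hL.le]
  have e3 : (h ^ 2) ^ θ = (h ^ θ) ^ 2 := by
    rw [← Real.rpow_natCast, ← Real.rpow_natCast, ← Real.rpow_mul hh.le, ← Real.rpow_mul hh.le,
      mul_comm]
  rw [e3, mul_left_comm, ← Real.rpow_add hL]
  congr 2
  ring

set_option maxHeartbeats 1000000 in
lemma aux_mode (μ : ℝ) (κ : ℕ) (hκ : 1 ≤ κ)
    (hμl : ((κ : ℝ) - 1) ^ 2 * Real.pi ^ 2 ≤ μ) (hμu : μ < (κ : ℝ) ^ 2 * Real.pi ^ 2)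
    (T : ℝ) (hT : 0 < T) :
    ∃ D > (0:ℝ), ∀ M : ℕ, 0 < M →
      (κ = 1 ∨ (2 ≤ κ ∧ (T / M) * μ ^ 2 < 1 / 4)) → ∀ k : ℕ,
      (T / M) * ∑ m ∈ Finset.Icc 1 M, (((1 + (T / M) * muK μ (k + 1))⁻¹) ^ m -
          Real.exp (-((T / M) * muK μ (k + 1))) ^ m) ^ 2 ≤ D * (lam (k + 1) ^ 4)⁻¹ ∧
      (T / M) * ∑ m ∈ Finset.Icc 1 M, (((1 + (T / M) * muK μ (k + 1))⁻¹) ^ m -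
          Real.exp (-((T / M) * muK μ (k + 1))) ^ m) ^ 2 ≤ D * ((T / M) ^ 2 * lam (k + 1) ^ 4) := by
  have hpi := Real.pi_gt_three
  have hκr : (1 : ℝ) ≤ κ := by exact_mod_cast hκ
  have hμ0 : 0 ≤ μ := le_trans (by positivity) hμl
  have hB : 0 < (κ : ℝ) ^ 2 * Real.pi ^ 2 := by positivity
  obtain ⟨δ, hδ⟩ : ∃ δ, δ = 1 - μ / ((κ : ℝ) ^ 2 * Real.pi ^ 2) := ⟨_, rfl⟩
  have hδ0 : 0 < δ := by
    rw [hδ, sub_pos, div_lt_one hB]; exact hμu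
  obtain ⟨K, hK⟩ : ∃ K, K = T * μ ^ 4 * Real.exp (2 * (T * μ ^ 2)) := ⟨_, rfl⟩
  have hK0 : 0 ≤ K := by rw [hK]; positivity
  refine ⟨4 + 1 / δ + T * K ^ 2 + T ^ 3 * K ^ 2 * μ ^ 2, by positivity, ?_⟩
  intro M hM hcase k
  have hMr : (1 : ℝ) ≤ M := by exact_mod_cast hM
  have hL1 : 1 ≤ lam (k + 1) := by
    unfold lam; push_cast
    have : (0 : ℝ) ≤ k := by positivity
    nlinarith
  have hh : 0 < T / M := by positivity
  have hhT : T / M ≤ T := div_le_self hT.le hMr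
  have hMh : (M : ℝ) * (T / M) = T := by field_simp
  have hmu : muK μ (k + 1) = lam (k + 1) ^ 2 * (lam (k + 1) ^ 2 - μ) := rfl
  have hlam : lam (k + 1) ^ 2 = ((k : ℝ) + 1) ^ 2 * Real.pi ^ 2 := by
    unfold lam; push_cast; ring
  generalize T / (M : ℝ) = h at *
  generalize muK μ (k + 1) = ν at *
  generalize lam (k + 1) = L at *
  have hL4 : 1 ≤ L ^ 4 := one_le_pow₀ hL1
  have hL2 : 1 ≤ L ^ 2 := one_le_pow₀ hL1
  have d1 : 0 ≤ 1 / δ := by positivity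
  have d2 : 0 ≤ T * K ^ 2 := by positivity
  have d3 : 0 ≤ T ^ 3 * K ^ 2 * μ ^ 2 := by positivity
  rcases le_or_gt κ (k + 1) with hk | hk
  · have hk' : (κ : ℝ) ≤ k + 1 := by exact_mod_cast hk
    have hBL : (κ : ℝ) ^ 2 * Real.pi ^ 2 ≤ L ^ 2 := by rw [hlam]; gcongr
    have hμe : μ = (1 - δ) * ((κ : ℝ) ^ 2 * Real.pi ^ 2) := by
      rw [hδ]; field_simp; ring
    have hδ1 : 0 ≤ 1 - δ := by
      rw [hδ]; have : 0 ≤ μ / ((κ : ℝ) ^ 2 * Real.pi ^ 2) := by positivity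
      linarith
    have hμL : μ ≤ (1 - δ) * L ^ 2 := by
      rw [hμe]; gcongr
    have hν1 : δ * L ^ 4 ≤ ν := by rw [hmu]; nlinarith
    have hν2 : ν ≤ L ^ 4 := by rw [hmu]; nlinarith
    have hν0 : 0 < ν := lt_of_lt_of_le (by positivity) hν1
    obtain ⟨s1, s2⟩ := aux_pos (h * ν) (by positivity) M
    constructor
    · calc _ ≤ h * (1 / (h * ν)) := by gcongr
        _ = 1 / ν := by field_simp
        _ ≤ 1 / (δ * L ^ 4) := by gcongr
        _ = 1 / δ * (L ^ 4)⁻¹ := by field_simp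
        _ ≤ _ := by
          gcongr
          linarith
    · calc _ ≤ h * (4 * (h * ν)) := by gcongr
        _ = 4 * (h ^ 2 * ν) := by ring
        _ ≤ 4 * (h ^ 2 * L ^ 4) := by gcongr
        _ ≤ _ := by
          gcongr
          linarith
  · have hk' : (k : ℝ) + 1 ≤ κ - 1 := by
      have : (k : ℝ) + 1 + 1 ≤ κ := by exact_mod_cast hk
      linarith
    have hLμ : L ^ 2 ≤ μ := by
      refine le_trans ?_ hμl
      rw [hlam]; gcongr
    have hsm : h * μ ^ 2 < 1 / 4 := by
      rcases hcase with h1 | h1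
      · omega
      · exact h1.2
    have hν0 : ν ≤ 0 := by rw [hmu]; nlinarith
    have hν1 : -ν ≤ μ ^ 2 := by rw [hmu]; nlinarith
    have hx0 : h * ν ≤ 0 := by nlinarith
    have hx1 : -(1 / 2) ≤ h * ν := by nlinarith
    have s := aux_neg (h * ν) hx1 hx0 M
    have hb : (M : ℝ) * (h * ν) ^ 2 * Real.exp (2 * (M * -(h * ν))) ≤ K * h := by
      have e1 : (M : ℝ) * (h * ν) ^ 2 = T * h * ν ^ 2 := by rw [← hMh]; ring
      have e2 : (M : ℝ) * -(h * ν) = T * (-ν) := by rw [← hMh]; ring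
      have e3 : ν ^ 2 ≤ μ ^ 4 := by
        have := pow_le_pow_left₀ (neg_nonneg.mpr hν0) hν1 2
        calc ν ^ 2 = (-ν) ^ 2 := by ring
          _ ≤ (μ ^ 2) ^ 2 := this
          _ = μ ^ 4 := by ring
      rw [e1, e2, hK]
      calc _ ≤ T * h * μ ^ 4 * Real.exp (2 * (T * μ ^ 2)) := by gcongr
        _ = _ := by ring
    have hA : h * ∑ m ∈ Finset.Icc 1 M, (((1 + h * ν)⁻¹) ^ m -
          Real.exp (-(h * ν)) ^ m) ^ 2 ≤ T * K ^ 2 * h ^ 2 := by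
      calc _ ≤ h * (M * (M * (h * ν) ^ 2 * Real.exp (2 * (M * -(h * ν)))) ^ 2) := by gcongr
        _ ≤ h * (M * (K * h) ^ 2) := by gcongr
        _ = T * K ^ 2 * h ^ 2 := by rw [← hMh]; ring
    constructor
    · refine hA.trans ?_
      rw [← div_eq_mul_inv, le_div_iff₀ (by positivity)]
      have hL4' : L ^ 4 ≤ μ ^ 2 := by
        have := pow_le_pow_left₀ (by positivity) hLμ 2
        calc L ^ 4 = (L ^ 2) ^ 2 := by ring
          _ ≤ μ ^ 2 := this
      calc T * K ^ 2 * h ^ 2 * L ^ 4 ≤ T * K ^ 2 * T ^ 2 * μ ^ 2 := by gcongr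
        _ = T ^ 3 * K ^ 2 * μ ^ 2 := by ring
        _ ≤ _ := by linarith
    · refine hA.trans ?_
      calc T * K ^ 2 * h ^ 2 = T * K ^ 2 * (h ^ 2 * 1) := by ring
        _ ≤ T * K ^ 2 * (h ^ 2 * L ^ 4) := by gcongr
        _ ≤ _ := by
          gcongr
          linarith

/-- Assume `κ = 1`, or `κ ≥ 2` and `Δτ μ² < 1/4` (with `Δτ = T/M`). Then there is `C > 0`,
independent of `Δτ` and of `(c_k)`, such that for every `θ ∈ [0,1]` and every real sequence
`(c_k)` with `∑_k λ_k⁴ c_k² < ∞`: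
`(∑_{m=1}^M Δτ ∑_k ((1+Δτμ_k)^{-m} − e^{-μ_k mΔτ})² c_k²)^{1/2}
  ≤ C Δτ^θ (∑_k λ_k^{2(4θ−2)} c_k²)^{1/2}`. -/
theorem stmt_9 (μ : ℝ) (κ : ℕ) (hκ : 1 ≤ κ)
    (hμl : ((κ : ℝ) - 1) ^ 2 * Real.pi ^ 2 ≤ μ) (hμu : μ < (κ : ℝ) ^ 2 * Real.pi ^ 2)
    (T : ℝ) (hT : 0 < T) :
    ∃ C > (0:ℝ), ∀ M : ℕ, 0 < M →
      (κ = 1 ∨ (2 ≤ κ ∧ (T / M) * μ ^ 2 < 1 / 4)) →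
      ∀ θ ∈ Set.Icc (0:ℝ) 1, ∀ c : ℕ → ℝ,
        Summable (fun k : ℕ => lam (k + 1) ^ 4 * (c (k + 1)) ^ 2) →
        Real.sqrt (∑ m ∈ Finset.Icc 1 M, (T / M) *
            ∑' k : ℕ,
              ((1 + (T / M) * muK μ (k + 1)) ^ (-(m : ℤ)) -
                  Real.exp (-(muK μ (k + 1)) * ((m : ℝ) * (T / M)))) ^ 2 * (c (k + 1)) ^ 2)
          ≤ C * (T / M) ^ θ *
            Real.sqrt (∑' k : ℕ, lam (k + 1) ^ (2 * (4 * θ - 2)) * (c (k + 1)) ^ 2) := by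
  obtain ⟨D, hD, hmode⟩ := aux_mode μ κ hκ hμl hμu T hT
  refine ⟨Real.sqrt D, Real.sqrt_pos.mpr hD, ?_⟩
  intro M hM hcase θ hθ c hc
  have hm := hmode M hM hcase
  have hh : 0 < T / M := by positivity
  have hL1 : ∀ k : ℕ, 1 ≤ lam (k + 1) := by
    intro k
    unfold lam; push_cast
    have : (0 : ℝ) ≤ k := by positivity
    nlinarith [Real.pi_gt_three]
  have hE : ∀ (m k : ℕ), (1 + (T / M) * muK μ (k + 1)) ^ (-(m : ℤ)) -
      Real.exp (-(muK μ (k + 1)) * ((m : ℝ) * (T / M))) =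
      ((1 + (T / M) * muK μ (k + 1))⁻¹) ^ m - Real.exp (-((T / M) * muK μ (k + 1))) ^ m := by
    intro m k
    rw [zpow_neg, zpow_natCast, inv_pow, ← Real.exp_nat_mul]
    congr 2
    ring
  simp only [hE]
  generalize T / (M : ℝ) = h at *
  set F : ℕ → ℕ → ℝ := fun m k => ((1 + h * muK μ (k + 1))⁻¹) ^ m -
    Real.exp (-(h * muK μ (k + 1))) ^ m with hF
  have hmb : ∀ k, h * ∑ m ∈ Finset.Icc 1 M, F m k ^ 2 ≤
      D * ((h ^ θ) ^ 2 * lam (k + 1) ^ (2 * (4 * θ - 2))) := by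
    intro k
    have hL0 : 0 < lam (k + 1) := by linarith [hL1 k]
    rw [← aux_pq h _ θ hh hL0]
    exact aux_interp _ D _ _ θ
      (mul_nonneg hh.le (Finset.sum_nonneg fun _ _ => sq_nonneg _)) hD
      (by positivity) (by positivity) hθ.1 hθ.2 (hm k).1 (hm k).2
  have hR : Summable (fun k : ℕ => lam (k + 1) ^ (2 * (4 * θ - 2)) * (c (k + 1)) ^ 2) := by
    refine Summable.of_nonneg_of_le (fun k => ?_) (fun k => ?_) hc
    · have : 0 < lam (k + 1) := by linarith [hL1 k]
      positivity
    · have e : lam (k + 1) ^ 4 = lam (k + 1) ^ (4 : ℝ) := by norm_cast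
      rw [e]
      gcongr
      · exact hL1 k
      · linarith [hθ.2]
  have hS : ∀ m ∈ Finset.Icc 1 M, Summable (fun k : ℕ => h * (F m k ^ 2 * c (k + 1) ^ 2)) := by
    intro m hmM
    refine Summable.of_nonneg_of_le (fun k => by positivity) (fun k => ?_)
      (hR.mul_left (D * (h ^ θ) ^ 2))
    have h1 : F m k ^ 2 ≤ ∑ m ∈ Finset.Icc 1 M, F m k ^ 2 :=
      Finset.single_le_sum (f := fun m => F m k ^ 2) (fun _ _ => sq_nonneg _) hmM
    have h2 := (mul_le_mul_of_nonneg_left h1 hh.le).trans (hmb k)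
    have h3 := mul_le_mul_of_nonneg_right h2 (sq_nonneg (c (k + 1)))
    linarith
  have hkey : ∑ m ∈ Finset.Icc 1 M, h * ∑' k : ℕ, F m k ^ 2 * c (k + 1) ^ 2 ≤
      (D * (h ^ θ) ^ 2) * ∑' k : ℕ, lam (k + 1) ^ (2 * (4 * θ - 2)) * (c (k + 1)) ^ 2 := by
    simp_rw [← tsum_mul_left]
    rw [← Summable.tsum_finsetSum hS]
    refine Summable.tsum_le_tsum (fun k => ?_) (summable_sum hS) (hR.mul_left _)
    have h3 := mul_le_mul_of_nonneg_right (hmb k) (sq_nonneg (c (k + 1)))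
    rw [← Finset.mul_sum, ← Finset.sum_mul]
    linarith
  refine (Real.sqrt_le_sqrt hkey).trans (le_of_eq ?_)
  rw [Real.sqrt_mul (by positivity), Real.sqrt_mul hD.le, Real.sqrt_sq (by positivity)]
end

section
/- Assume that κ = 1, or that κ ≥ 2 and Δτ μ² < 1/4. Then there exists a constant C > 0, independent of Δτ and of the sequence (c_k), such that for every real sequence (c_k)_{k∈ℕ}: ( ∑_{m=1}^M Δτ · ∑_{k=1}^∞ (1 + Δτ μ_k)^{-2m} c_k² )^{1/2} ≤ C · ( ∑_{k=1}^∞ λ_k^{-4} c_k² )^{1/2}, where both sides may equal +∞. -/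
theorem geom_aux (x : ℝ) (hx : 0 < x) (M : ℕ) :
    ∑ m ∈ Finset.Icc 1 M, x * (1 + x) ^ (-(2 * (m : ℤ))) ≤ 1 := by
  have h1 : ∀ M : ℕ, ∑ m ∈ Finset.Icc 1 M, x * ((1 + x)⁻¹) ^ m = 1 - ((1 + x)⁻¹) ^ M := by
    intro M
    induction M with
    | zero => simp
    | succ n ih =>
      rw [Finset.sum_Icc_succ_top (by omega), ih, pow_succ]
      have : (1 + x) ≠ 0 := by positivity
      field_simp
      ring
  have h2 : ∑ m ∈ Finset.Icc 1 M, x * (1 + x) ^ (-(2 * (m : ℤ)))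
      ≤ ∑ m ∈ Finset.Icc 1 M, x * ((1 + x)⁻¹) ^ m := by
    apply Finset.sum_le_sum
    intro m _
    apply mul_le_mul_of_nonneg_left _ hx.le
    rw [inv_pow, ← zpow_natCast, ← zpow_neg]
    exact zpow_le_zpow_right₀ (by linarith) (by omega)
  rw [h1] at h2
  have : 0 ≤ ((1 + x)⁻¹) ^ M := by positivity
  linarith

theorem low_aux (y S T : ℝ) (m : ℕ) (d : ℝ) (hd : 0 ≤ d) (hS : 0 ≤ S) (hm : m * d ≤ T)
    (hy : -(S / 4) ≤ y) (hds : d * S < 1 / 4) :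
    (1 + d * y) ^ (-(2 * (m : ℤ))) ≤ Real.exp (T * S) := by
  have ha : 1 - d * S / 4 ≤ 1 + d * y := by nlinarith
  have hp : 0 ≤ d * S := by positivity
  have hpos : 0 < 1 + d * y := by linarith
  have h1 : (1 + d * y)⁻¹ ≤ Real.exp (d * S / 2) := by
    have h2 : d * S / 2 + 1 ≤ Real.exp (d * S / 2) := Real.add_one_le_exp _
    refine le_trans ?_ h2
    rw [inv_le_iff_one_le_mul₀ hpos]
    nlinarith
  have e : (1 + d * y) ^ (-(2 * (m : ℤ))) = ((1 + d * y)⁻¹) ^ (2 * m) := by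
    rw [zpow_neg, inv_pow, ← zpow_natCast]; push_cast; rfl
  rw [e]
  calc ((1 + d * y)⁻¹) ^ (2 * m) ≤ (Real.exp (d * S / 2)) ^ (2 * m) := by
        gcongr
    _ = Real.exp ((m * d) * S) := by
        rw [← Real.exp_nat_mul]; congr 1; push_cast; ring
    _ ≤ _ := by gcongr

theorem key_aux (μ : ℝ) (κ : ℕ) (hκ : 1 ≤ κ)
    (hμl : ((κ : ℝ) - 1) ^ 2 * Real.pi ^ 2 ≤ μ) (hμu : μ < (κ : ℝ) ^ 2 * Real.pi ^ 2)
    (T : ℝ) (hT : 0 < T) :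
    ∃ K > (0:ℝ), ∀ M : ℕ, 0 < M →
      (κ = 1 ∨ (2 ≤ κ ∧ (T / M) * μ ^ 2 < 1 / 4)) →
      ∀ k : ℕ, ∑ m ∈ Finset.Icc 1 M, (T / M) *
        (1 + (T / M) * muK μ (k + 1)) ^ (-(2 * (m : ℤ))) ≤ K * (lam (k + 1) ^ 4)⁻¹ := by
  have hpi := Real.pi_pos
  have hμ0 : 0 ≤ μ := le_trans (by positivity) hμl
  have hκ' : (0:ℝ) < κ := by exact_mod_cast hκ
  set L : ℝ := (κ : ℝ) ^ 2 * Real.pi ^ 2 with hL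
  have hLp : 0 < L := by positivity
  have hδ : 0 < L - μ := by linarith
  refine ⟨L / (L - μ) + T * Real.exp (T * μ ^ 2) * L ^ 2, by positivity, ?_⟩
  intro M hM hyp k
  have hM' : (0:ℝ) < M := by exact_mod_cast hM
  have hd : 0 < T / M := by positivity
  have hMd : M * (T / M) = T := by field_simp
  set d := T / (M:ℝ)
  have hl : 0 < lam (k + 1) := by unfold lam; positivity
  by_cases hk : κ ≤ k + 1
  · have hlL : L ≤ lam (k + 1) ^ 2 := by
      have : (κ : ℝ) ≤ ((k + 1 : ℕ) : ℝ) := by exact_mod_cast hk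
      unfold lam; rw [mul_pow, hL]; gcongr
    have hmu : 0 < muK μ (k + 1) := by
      unfold muK; apply mul_pos (by positivity); linarith
    have h1 := geom_aux (d * muK μ (k + 1)) (by positivity) M
    have h2 : ∑ m ∈ Finset.Icc 1 M, d * (1 + d * muK μ (k + 1)) ^ (-(2 * (m : ℤ)))
        ≤ (muK μ (k + 1))⁻¹ := by
      rw [inv_eq_one_div, le_div_iff₀ hmu, Finset.sum_mul]
      refine le_trans (le_of_eq ?_) h1
      apply Finset.sum_congr rfl
      intro m _
      ring
    refine h2.trans ?_
    have h3 : (muK μ (k + 1))⁻¹ ≤ L / (L - μ) * (lam (k + 1) ^ 4)⁻¹ := by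
      rw [← div_eq_mul_inv, div_div, inv_eq_one_div, div_le_div_iff₀ hmu (by positivity)]
      unfold muK
      have : 0 ≤ lam (k+1) ^ 2 * μ * (lam (k + 1) ^ 2 - L) := by
        apply mul_nonneg (by positivity); linarith
      nlinarith
    refine h3.trans ?_
    gcongr
    have : 0 ≤ T * Real.exp (T * μ ^ 2) * L ^ 2 := by positivity
    linarith
  · rcases hyp with h | ⟨_, h⟩
    · omega
    have hlL : lam (k + 1) ^ 2 ≤ L := by
      have : ((k + 1 : ℕ) : ℝ) ≤ (κ : ℝ) := by exact_mod_cast (by omega)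
      unfold lam; rw [mul_pow, hL]; gcongr
    have h1 : ∑ m ∈ Finset.Icc 1 M, d * (1 + d * muK μ (k + 1)) ^ (-(2 * (m : ℤ)))
        ≤ ∑ m ∈ Finset.Icc 1 M, d * Real.exp (T * μ ^ 2) := by
      apply Finset.sum_le_sum
      intro m hm
      rw [Finset.mem_Icc] at hm
      apply mul_le_mul_of_nonneg_left _ hd.le
      apply low_aux _ (μ ^ 2) T m d hd.le (by positivity) _ _ h
      · rw [← hMd]
        have : (m : ℝ) ≤ M := by exact_mod_cast hm.2
        gcongr
      · unfold muK; nlinarith [sq_nonneg (lam (k + 1) ^ 2 - μ / 2)]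
    refine h1.trans ?_
    rw [Finset.sum_const, Nat.card_Icc, nsmul_eq_mul, Nat.add_sub_cancel, ← mul_assoc, hMd]
    rw [← div_eq_mul_inv, le_div_iff₀ (by positivity)]
    have h4 : lam (k + 1) ^ 4 ≤ L ^ 2 := by
      have : lam (k + 1) ^ 4 = (lam (k + 1) ^ 2) ^ 2 := by ring
      rw [this]; gcongr
    have h5 : T * Real.exp (T * μ ^ 2) * lam (k + 1) ^ 4 ≤ T * Real.exp (T * μ ^ 2) * L ^ 2 := by
      gcongr
    have : 0 < L / (L - μ) := by positivity
    linarith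

/-- Assume `κ = 1`, or `κ ≥ 2` and `Δτ μ² < 1/4` (with `Δτ = T/M`). Then there is `C > 0`,
independent of `Δτ` and of `(c_k)`, such that for every real sequence `(c_k)`:
`(∑_{m=1}^M Δτ ∑_k (1+Δτμ_k)^{-2m} c_k²)^{1/2} ≤ C (∑_k λ_k^{-4} c_k²)^{1/2}`,
where both sides may equal `+∞`. -/
theorem stmt_10 (μ : ℝ) (κ : ℕ) (hκ : 1 ≤ κ)
    (hμl : ((κ : ℝ) - 1) ^ 2 * Real.pi ^ 2 ≤ μ) (hμu : μ < (κ : ℝ) ^ 2 * Real.pi ^ 2)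
    (T : ℝ) (hT : 0 < T) :
    ∃ C > (0:ℝ), ∀ M : ℕ, 0 < M →
      (κ = 1 ∨ (2 ≤ κ ∧ (T / M) * μ ^ 2 < 1 / 4)) →
      ∀ c : ℕ → ℝ,
        (∑ m ∈ Finset.Icc 1 M, ENNReal.ofReal (T / M) *
            ∑' k : ℕ, ENNReal.ofReal
              ((1 + (T / M) * muK μ (k + 1)) ^ (-(2 * (m : ℤ))) * (c (k + 1)) ^ 2)) ^ ((1:ℝ)/2)
          ≤ ENNReal.ofReal C *
            (∑' k : ℕ, ENNReal.ofReal ((lam (k + 1) ^ 4)⁻¹ * (c (k + 1)) ^ 2)) ^ ((1:ℝ)/2) := by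
  obtain ⟨K, hK, hkey⟩ := key_aux μ κ hκ hμl hμu T hT
  refine ⟨√K, Real.sqrt_pos.mpr hK, ?_⟩
  intro M hM hyp c
  have hM' : (0:ℝ) < M := by exact_mod_cast hM
  have hd : 0 < T / M := by positivity
  have e : ENNReal.ofReal (√K) = (ENNReal.ofReal K) ^ ((1:ℝ)/2) := by
    rw [Real.sqrt_eq_rpow, ENNReal.ofReal_rpow_of_pos hK]
  rw [e, ← ENNReal.mul_rpow_of_nonneg _ _ (by norm_num)]
  apply ENNReal.rpow_le_rpow _ (by norm_num)
  simp_rw [← ENNReal.tsum_mul_left]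
  rw [← Summable.tsum_finsetSum (fun _ _ => ENNReal.summable)]
  apply ENNReal.tsum_le_tsum
  intro k
  have hnn : ∀ m : ℕ, 0 ≤ (1 + (T / M) * muK μ (k + 1)) ^ (-(2 * (m : ℤ))) := by
    intro m
    apply Even.zpow_nonneg
    exact ((even_two_mul (m : ℤ))).neg
  simp_rw [← ENNReal.ofReal_mul hd.le]
  rw [← ENNReal.ofReal_mul hK.le, ← ENNReal.ofReal_sum_of_nonneg]
  · apply ENNReal.ofReal_le_ofReal
    have := mul_le_mul_of_nonneg_right (hkey M hM hyp k) (sq_nonneg (c (k + 1)))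
    rw [Finset.sum_mul] at this
    simpa only [mul_assoc] using this
  · intro m _
    have := hnn m
    positivity
end

section
/- There exists a constant C > 0, independent of Δτ and of m, such that for every M ∈ ℕ and every m ∈ {1,…,M}: ∑_{k=1}^∞ λ_k² · ∑_{ℓ=1}^m ∫_{τ_{ℓ−1}}^{τ_ℓ} e^{-2μ_k(τ_m − τ)} · (1 − e^{-μ_k(τ − τ_{ℓ−1})})² dτ ≤ C · (1 + Δτ^{3/4} + Δτ^{7/4}) · Δτ^{1/4}. -/
lemma tele_aux (F : ℝ → ℝ) (m : ℕ) :
    ∑ l ∈ Finset.Icc 1 m, (F (l:ℝ) - F ((l:ℝ) - 1)) = F m - F 0 := by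
  induction m with
  | zero => simp
  | succ n ih =>
    rw [Finset.sum_Icc_succ_top (by omega), ih]
    push_cast
    rw [add_sub_cancel_right]; ring

lemma int_aux (ν t a b : ℝ) (hν : ν ≠ 0) :
    ∫ τ in a..b, Real.exp (-(2 * ν) * (t - τ)) =
      Real.exp (-(2 * ν) * (t - b)) / (2 * ν) - Real.exp (-(2 * ν) * (t - a)) / (2 * ν) := by
  apply intervalIntegral.integral_eq_sub_of_hasDerivAt
    (f := fun τ => Real.exp (-(2 * ν) * (t - τ)) / (2 * ν))
  · intro x _
    have h1 : HasDerivAt (fun τ : ℝ => -(2 * ν) * (t - τ)) (-(2 * ν) * (-1)) x :=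
      ((hasDerivAt_id x).const_sub t).const_mul _
    have h2 := h1.exp.div_const (2 * ν)
    have h3 : (2 * ν) ≠ 0 := mul_ne_zero two_ne_zero hν
    have h4 : Real.exp (-(2 * ν) * (t - x)) * (-(2 * ν) * -1) / (2 * ν) =
        Real.exp (-(2 * ν) * (t - x)) := by
      rw [div_eq_iff h3]; ring
    rw [h4] at h2
    exact h2
  · apply Continuous.intervalIntegrable
    fun_prop

lemma pos_aux (ν D q : ℝ) (hν : 0 < ν) (hD : 0 < D) (m : ℕ) (hq0 : 0 ≤ q)
    (hq : ∀ y, 0 ≤ y → y ≤ D → (1 - Real.exp (-ν * y)) ^ 2 ≤ q) :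
    ∑ l ∈ Finset.Icc 1 m,
      ∫ τ in (((l : ℝ) - 1) * D)..((l : ℝ) * D),
        Real.exp (-(2 * ν) * ((m : ℝ) * D - τ)) *
          (1 - Real.exp (-ν * (τ - ((l : ℝ) - 1) * D))) ^ 2 ≤ q / (2 * ν) := by
  set F : ℝ → ℝ := fun x => q * (Real.exp (-(2 * ν) * ((m:ℝ) * D - x * D)) / (2 * ν)) with hF
  have h1 : ∀ l ∈ Finset.Icc 1 m,
      ∫ τ in (((l : ℝ) - 1) * D)..((l : ℝ) * D),
        Real.exp (-(2 * ν) * ((m : ℝ) * D - τ)) *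
          (1 - Real.exp (-ν * (τ - ((l : ℝ) - 1) * D))) ^ 2 ≤ F (l:ℝ) - F ((l:ℝ) - 1) := by
    intro l _
    have : F (l:ℝ) - F ((l:ℝ) - 1) = ∫ τ in (((l : ℝ) - 1) * D)..((l : ℝ) * D),
        q * Real.exp (-(2 * ν) * ((m : ℝ) * D - τ)) := by
      rw [intervalIntegral.integral_const_mul, int_aux _ _ _ _ hν.ne']
      simp only [hF]; ring
    rw [this]
    apply intervalIntegral.integral_mono_on
    · nlinarith
    · apply Continuous.intervalIntegrable
      fun_prop
    · apply Continuous.intervalIntegrable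
      fun_prop
    · intro x hx
      rw [mul_comm q]
      apply mul_le_mul_of_nonneg_left _ (Real.exp_pos _).le
      apply hq
      · linarith [hx.1]
      · linarith [hx.2]
  refine (Finset.sum_le_sum h1).trans ?_
  rw [tele_aux]
  have h2 : F m = q / (2 * ν) := by simp [hF]; ring
  have h3 : 0 ≤ F 0 := by simp only [hF]; positivity
  linarith

lemma gen_aux (ν D T : ℝ) (hD : 0 < D) (m : ℕ) (hmT : (m:ℝ) * D ≤ T) (hDT : D ≤ T) :
    ∑ l ∈ Finset.Icc 1 m,
      ∫ τ in (((l : ℝ) - 1) * D)..((l : ℝ) * D),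
        Real.exp (-(2 * ν) * ((m : ℝ) * D - τ)) *
          (1 - Real.exp (-ν * (τ - ((l : ℝ) - 1) * D))) ^ 2 ≤
      T * (Real.exp (2 * |ν| * T) * (|ν| * Real.exp (|ν| * T)) ^ 2) * D ^ 2 := by
  set K := Real.exp (2 * |ν| * T) * (|ν| * D * Real.exp (|ν| * T)) ^ 2 with hK
  have hK0 : 0 ≤ K := by positivity
  have h1 : ∀ l ∈ Finset.Icc 1 m,
      ∫ τ in (((l : ℝ) - 1) * D)..((l : ℝ) * D),
        Real.exp (-(2 * ν) * ((m : ℝ) * D - τ)) *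
          (1 - Real.exp (-ν * (τ - ((l : ℝ) - 1) * D))) ^ 2 ≤ D * K := by
    intro l hl
    have : D * K = ∫ τ in (((l : ℝ) - 1) * D)..((l : ℝ) * D), K := by
      rw [intervalIntegral.integral_const, smul_eq_mul]; ring
    rw [this]
    apply intervalIntegral.integral_mono_on
    · nlinarith
    · apply Continuous.intervalIntegrable
      fun_prop
    · apply Continuous.intervalIntegrable
      fun_prop
    · intro x hx
      have hl' := Finset.mem_Icc.1 hl
      have hl1 : (1:ℝ) ≤ l := by exact_mod_cast hl'.1
      have hl2 : (l:ℝ) ≤ m := by exact_mod_cast hl'.2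
      have hx0 : 0 ≤ x := le_trans (mul_nonneg (by linarith) hD.le) hx.1
      have hxm : x ≤ m * D := hx.2.trans (mul_le_mul_of_nonneg_right hl2 hD.le)
      apply mul_le_mul _ _ (sq_nonneg _) (Real.exp_pos _).le
      · apply Real.exp_le_exp.2
        have a1 : -ν ≤ |ν| := neg_le_abs ν
        have a2 : (m * D - x) * (-ν) ≤ (m * D - x) * |ν| :=
          mul_le_mul_of_nonneg_left a1 (by linarith)
        have a3 : (m * D - x) * |ν| ≤ T * |ν| :=
          mul_le_mul_of_nonneg_right (by linarith) (abs_nonneg _)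
        linarith
      · set y := x - ((l:ℝ) - 1) * D with hy
        have hy0 : 0 ≤ y := by linarith [hx.1]
        have hyD : y ≤ D := by linarith [hx.2]
        have b1 : |ν * y| ≤ |ν| * D := by
          rw [abs_mul, abs_of_nonneg hy0]
          exact mul_le_mul_of_nonneg_left hyD (abs_nonneg _)
        have b2 : |ν| * D ≤ |ν| * T := mul_le_mul_of_nonneg_left hDT (abs_nonneg _)
        have b3 : (1:ℝ) ≤ Real.exp (|ν| * T) := Real.one_le_exp (mul_nonneg (abs_nonneg _) (by linarith))
        apply sq_le_sq'
        · have c1 : Real.exp (-ν * y) - 1 ≤ |ν| * D * Real.exp (|ν| * T) := by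
            have d1 := Real.add_one_le_exp (ν * y)
            have d2 : Real.exp (-ν * y) * Real.exp (ν * y) = 1 := by
              rw [← Real.exp_add]; simp
            have d3 : Real.exp (-ν * y) ≤ Real.exp (|ν| * T) := by
              apply Real.exp_le_exp.2
              have := neg_abs_le (ν * y)
              linarith
            have d4 : Real.exp (-ν * y) - 1 ≤ Real.exp (-ν * y) * (-(ν * y)) := by
              nlinarith [Real.exp_pos (-ν * y)]
            have d5 : Real.exp (-ν * y) * (-(ν * y)) ≤ Real.exp (-ν * y) * (|ν| * D) :=
              mul_le_mul_of_nonneg_left ((neg_le_abs _).trans b1) (Real.exp_pos _).le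
            have d6 : Real.exp (-ν * y) * (|ν| * D) ≤ Real.exp (|ν| * T) * (|ν| * D) :=
              mul_le_mul_of_nonneg_right d3 (by positivity)
            linarith
          linarith
        · have c1 := Real.add_one_le_exp (-ν * y)
          have c2 := le_abs_self (ν * y)
          have c3 : |ν| * D * 1 ≤ |ν| * D * Real.exp (|ν| * T) :=
            mul_le_mul_of_nonneg_left b3 (by positivity)
          linarith
  refine (Finset.sum_le_sum h1).trans ?_
  rw [Finset.sum_const, Nat.card_Icc, nsmul_eq_mul, Nat.add_sub_cancel, ← mul_assoc]
  refine (mul_le_mul_of_nonneg_right hmT hK0).trans (le_of_eq ?_)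
  rw [hK]; ring

lemma one_sub_exp_aux (ν D y : ℝ) (hν : 0 < ν) (hy0 : 0 ≤ y) (hy : y ≤ D) :
    (1 - Real.exp (-ν * y)) ^ 2 ≤ min 1 ((ν * D) ^ 2) := by
  have h1 : Real.exp (-ν * y) ≤ 1 := Real.exp_le_one_iff.2 (by nlinarith)
  have h2 := Real.exp_pos (-ν * y)
  have h3 := Real.add_one_le_exp (-ν * y)
  have h4 : ν * y ≤ ν * D := mul_le_mul_of_nonneg_left hy hν.le
  apply le_min
  · nlinarith
  · apply pow_le_pow_left₀ <;> linarith

lemma tail_aux (lm ν c s n : ℝ) (hlm : n ≤ lm) (hn : 1 ≤ n) (hs : 0 < s) (hc : 0 < c)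
    (h1 : c * lm ^ 4 ≤ ν) (h2 : ν ≤ lm ^ 4) :
    lm ^ 2 * (min 1 ((ν * s ^ 4) ^ 2) / (2 * ν)) ≤
      2 / c * s * (s / (1 + n * s) ^ 2) := by
  have hl : 0 < lm := by linarith
  have hν : 0 < ν := lt_of_lt_of_le (by positivity) h1
  set x := lm * s with hx
  have hx0 : 0 < x := by positivity
  have e1 : (ν * s ^ 4) ^ 2 ≤ x ^ 8 := by
    have : ν * s ^ 4 ≤ x ^ 4 := by
      rw [hx, mul_pow]; exact mul_le_mul_of_nonneg_right h2 (by positivity)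
    calc (ν * s ^ 4) ^ 2 ≤ (x ^ 4) ^ 2 := pow_le_pow_left₀ (by positivity) this 2
      _ = x ^ 8 := by ring
  have e2 : min 1 ((ν * s ^ 4) ^ 2) ≤ 2 * x ^ 2 / (1 + x ^ 2) := by
    rw [le_div_iff₀ (by positivity)]
    rcases le_total x 1 with h | h
    · have f1 : min 1 ((ν * s ^ 4) ^ 2) ≤ x ^ 2 :=
        (min_le_right _ _).trans (e1.trans (pow_le_pow_of_le_one hx0.le h (by norm_num)))
      have : x ^ 2 ≤ 1 := pow_le_one₀ hx0.le h
      nlinarith [sq_nonneg x]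
    · have f1 : min 1 ((ν * s ^ 4) ^ 2) ≤ 1 := min_le_left _ _
      have : 1 ≤ x ^ 2 := one_le_pow₀ h
      nlinarith
  have e3 : (1 + n * s) ^ 2 ≤ 2 * (1 + x ^ 2) := by
    have : n * s ≤ x := mul_le_mul_of_nonneg_right hlm hs.le
    have : (1 + n * s) ^ 2 ≤ (1 + x) ^ 2 := pow_le_pow_left₀ (by positivity) (by linarith) 2
    nlinarith [sq_nonneg (1 - x)]
  calc lm ^ 2 * (min 1 ((ν * s ^ 4) ^ 2) / (2 * ν))
      ≤ lm ^ 2 * ((2 * x ^ 2 / (1 + x ^ 2)) / (2 * (c * lm ^ 4))) := by gcongr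
    _ = 1 / c * s ^ 2 * (1 / (1 + x ^ 2)) := by rw [hx]; field_simp
    _ ≤ 1 / c * s ^ 2 * (2 / (1 + n * s) ^ 2) := by
        apply mul_le_mul_of_nonneg_left _ (by positivity)
        rw [div_le_div_iff₀ (by positivity) (by positivity)]
        linarith
    _ = _ := by ring

lemma sum_aux (s : ℝ) (hs : 0 < s) (N : ℕ) :
    ∑ k ∈ Finset.range N, s / (1 + ((k:ℝ) + 1) * s) ^ 2 ≤ 1 := by
  have : ∑ k ∈ Finset.range N, s / (1 + ((k:ℝ) + 1) * s) ^ 2 ≤ 1 - 1 / (1 + N * s) := by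
    induction N with
    | zero => simp
    | succ n ih =>
      rw [Finset.sum_range_succ]
      have : s / (1 + ((n:ℝ) + 1) * s) ^ 2 ≤ 1 / (1 + n * s) - 1 / (1 + ((n:ℝ) + 1) * s) := by
        have h : 1 / (1 + n * s) - 1 / (1 + ((n:ℝ) + 1) * s) =
            s / ((1 + n * s) * (1 + ((n:ℝ) + 1) * s)) := by
          field_simp; ring
        rw [h, sq]
        gcongr
        linarith
      push_cast
      linarith
  have h : 0 ≤ 1 / (1 + N * s) := by positivity
  linarith

set_option maxHeartbeats 1000000 in
/-- There exists `C > 0`, independent of `Δτ` and of `m`, such that for every `M ∈ ℕ` and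
every `m ∈ {1,…,M}`:
`∑_k λ_k² ∑_{ℓ=1}^m ∫_{τ_{ℓ−1}}^{τ_ℓ} e^{-2μ_k(τ_m−τ)} (1 − e^{-μ_k(τ−τ_{ℓ−1})})² dτ
  ≤ C (1 + Δτ^{3/4} + Δτ^{7/4}) Δτ^{1/4}`, where `Δτ = T/M` and `τ_ℓ = ℓΔτ`. -/
theorem stmt_12 (μ : ℝ) (κ : ℕ) (hκ : 1 ≤ κ)
    (hμl : ((κ : ℝ) - 1) ^ 2 * Real.pi ^ 2 ≤ μ) (hμu : μ < (κ : ℝ) ^ 2 * Real.pi ^ 2)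
    (T : ℝ) (hT : 0 < T) :
    ∃ C > (0:ℝ), ∀ M : ℕ, 0 < M → ∀ m : ℕ, 1 ≤ m → m ≤ M →
      ∑' k : ℕ, lam (k + 1) ^ 2 *
          ∑ l ∈ Finset.Icc 1 m,
            ∫ τ in (((l : ℝ) - 1) * (T / M))..((l : ℝ) * (T / M)),
              Real.exp (-(2 * muK μ (k + 1)) * ((m : ℝ) * (T / M) - τ)) *
                (1 - Real.exp (-(muK μ (k + 1)) * (τ - ((l : ℝ) - 1) * (T / M)))) ^ 2
        ≤ C * (1 + (T / M) ^ ((3:ℝ)/4) + (T / M) ^ ((7:ℝ)/4)) * (T / M) ^ ((1:ℝ)/4) := by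
  have hpi := Real.pi_pos
  have hκ' : (1:ℝ) ≤ κ := by exact_mod_cast hκ
  have hμ0 : 0 ≤ μ := le_trans (by positivity) hμl
  have hP : 0 < (κ:ℝ) ^ 2 * Real.pi ^ 2 := by positivity
  obtain ⟨c, hc⟩ : ∃ c : ℝ, c = 1 - μ / ((κ:ℝ) ^ 2 * Real.pi ^ 2) := ⟨_, rfl⟩
  have hc0 : 0 < c := by
    rw [hc, sub_pos, div_lt_one hP]; exact hμu
  have hcμ : (1 - c) * ((κ:ℝ) ^ 2 * Real.pi ^ 2) = μ := by
    rw [hc]; field_simp; ring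
  have hc1 : c ≤ 1 := by
    rw [hc]; linarith [div_nonneg hμ0 hP.le]
  set B : ℕ → ℝ := fun k => lam (k + 1) ^ 2 * (T * (Real.exp (2 * |muK μ (k + 1)| * T) *
    (|muK μ (k + 1)| * Real.exp (|muK μ (k + 1)| * T)) ^ 2)) with hB
  have hB0 : ∀ k, 0 ≤ B k := fun k => by simp only [hB]; positivity
  set S := ∑ k ∈ Finset.range κ, B k with hS
  have hS0 : 0 ≤ S := Finset.sum_nonneg fun k _ => hB0 k
  refine ⟨2 / c + S, by positivity, ?_⟩
  intro M hM m hm1 hmM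
  have hM' : (0:ℝ) < M := by exact_mod_cast hM
  have hmM' : (m:ℝ) ≤ M := by exact_mod_cast hmM
  have hm1' : (1:ℝ) ≤ m := by exact_mod_cast hm1
  obtain ⟨D, hDdef⟩ : ∃ D : ℝ, D = T / M := ⟨_, rfl⟩
  simp only [← hDdef]
  have hD : 0 < D := by rw [hDdef]; positivity
  have hMD : M * D = T := by rw [hDdef]; field_simp
  have hmT : (m:ℝ) * D ≤ T := by
    rw [← hMD]; exact mul_le_mul_of_nonneg_right hmM' hD.le
  have hDT : D ≤ T := by nlinarith
  obtain ⟨s, hsdef⟩ : ∃ s : ℝ, s = D ^ ((1:ℝ)/4) := ⟨_, rfl⟩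
  have hs : 0 < s := by rw [hsdef]; positivity
  have hs4 : s ^ 4 = D := by
    rw [hsdef, ← Real.rpow_natCast, ← Real.rpow_mul hD.le]; norm_num
  have hD2 : D ^ ((7:ℝ)/4) * s = D ^ 2 := by
    rw [hsdef, ← Real.rpow_add hD, ← Real.rpow_natCast]; norm_num
  rw [← hsdef]
  have hfin : 2 / c * s + S * D ^ 2 ≤
      (2 / c + S) * (1 + D ^ ((3:ℝ)/4) + D ^ ((7:ℝ)/4)) * s := by
    have p1 : 0 ≤ D ^ ((3:ℝ)/4) := by positivity
    have p2 : 0 ≤ D ^ ((7:ℝ)/4) := by positivity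
    have p3 : 0 < 2 / c := by positivity
    rw [← hD2]
    have : 0 ≤ 2 / c * (D ^ ((3:ℝ)/4) + D ^ ((7:ℝ)/4)) * s + S * (1 + D ^ ((3:ℝ)/4)) * s := by
      positivity
    nlinarith
  refine le_trans ?_ hfin
  apply Real.tsum_le_of_sum_range_le
  · intro k
    apply mul_nonneg (sq_nonneg _)
    apply Finset.sum_nonneg
    intro l _
    apply intervalIntegral.integral_nonneg
    · nlinarith
    · intro x _
      positivity
  intro N
  have key : ∀ k ∈ Finset.range N, lam (k + 1) ^ 2 *
          ∑ l ∈ Finset.Icc 1 m,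
            ∫ τ in (((l : ℝ) - 1) * D)..((l : ℝ) * D),
              Real.exp (-(2 * muK μ (k + 1)) * ((m : ℝ) * D - τ)) *
                (1 - Real.exp (-(muK μ (k + 1)) * (τ - ((l : ℝ) - 1) * D))) ^ 2
      ≤ 2 / c * s * (s / (1 + ((k:ℝ) + 1) * s) ^ 2) + (if k < κ then B k else 0) * D ^ 2 := by
    intro k _
    by_cases hk : k < κ
    · rw [if_pos hk]
      have h1 := mul_le_mul_of_nonneg_left (gen_aux (muK μ (k+1)) D T hD m hmT hDT)
        (sq_nonneg (lam (k+1)))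
      have h2 : 0 ≤ 2 / c * s * (s / (1 + ((k:ℝ) + 1) * s) ^ 2) := by positivity
      refine h1.trans ?_
      simp only [hB]
      linarith
    · rw [if_neg hk, zero_mul, add_zero]
      have hk' : (κ:ℝ) ≤ k := by exact_mod_cast not_lt.1 hk
      have hlam : lam (k+1) = ((k:ℝ) + 1) * Real.pi := by simp [lam]
      have hl1 : (k:ℝ) + 1 ≤ lam (k+1) := by
        rw [hlam]; nlinarith [Real.pi_gt_three]
      have hl2 : (κ:ℝ) ^ 2 * Real.pi ^ 2 ≤ lam (k+1) ^ 2 := by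
        rw [hlam, mul_pow]
        gcongr
        linarith
      have hl3 : μ ≤ (1 - c) * lam (k+1) ^ 2 := by
        rw [← hcμ]; exact mul_le_mul_of_nonneg_left hl2 (by linarith)
      have g1 : c * lam (k+1) ^ 4 ≤ muK μ (k+1) := by
        have := mul_le_mul_of_nonneg_left hl3 (sq_nonneg (lam (k+1)))
        unfold muK; linarith
      have g2 : muK μ (k+1) ≤ lam (k+1) ^ 4 := by
        have := mul_nonneg (sq_nonneg (lam (k+1))) hμ0
        unfold muK; linarith
      have hlp : 0 < lam (k+1) := by rw [hlam]; positivity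
      have hν : 0 < muK μ (k+1) := lt_of_lt_of_le (by positivity) g1
      have h1 := pos_aux (muK μ (k+1)) D (min 1 ((muK μ (k+1) * D) ^ 2)) hν hD m
        (by positivity) (fun y h0 h1 => one_sub_exp_aux _ _ _ hν h0 h1)
      refine (mul_le_mul_of_nonneg_left h1 (sq_nonneg _)).trans ?_
      rw [← hs4]
      exact tail_aux _ _ _ _ _ hl1 (by linarith) hs hc0 g1 g2
  refine (Finset.sum_le_sum key).trans ?_
  rw [Finset.sum_add_distrib, ← Finset.mul_sum, ← Finset.sum_mul]
  have hA := mul_le_mul_of_nonneg_left (sum_aux s hs N) (show 0 ≤ 2 / c * s by positivity)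
  have hBs : ∑ k ∈ Finset.range N, (if k < κ then B k else 0) ≤ S := by
    rw [← Finset.sum_filter]
    apply Finset.sum_le_sum_of_subset_of_nonneg
    · intro k hk
      exact Finset.mem_range.2 (Finset.mem_filter.1 hk).2
    · intro k _ _
      exact hB0 k
  have hBs' := mul_le_mul_of_nonneg_right hBs (sq_nonneg D)
  linarith
end

section
/- Let H be a real Hilbert space, T > 0, M ∈ ℕ, Δτ := T/M and τ_m := mΔτ for m = 0,…,M. Let f : [0,T] → H be continuously differentiable. Then ∑_{m=1}^M Δτ ‖f(τ_m)‖² ≤ 2 ∫_0^T ( ‖f(τ)‖² + τ² ‖f'(τ)‖² ) dτ. -/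
theorem aux_step {H : Type*} [NormedAddCommGroup H] [InnerProductSpace ℝ H]
    (T : ℝ) (f f' : ℝ → H)
    (hderiv : ∀ t ∈ Set.Icc (0:ℝ) T, HasDerivWithinAt f (f' t) (Set.Icc (0:ℝ) T) t)
    (hc : ContinuousOn (fun τ : ℝ => 2 * (‖f τ‖ ^ 2 + τ ^ 2 * ‖f' τ‖ ^ 2)) (Set.Icc (0:ℝ) T))
    (a b : ℝ) (ha : 0 ≤ a) (hab : a ≤ b) (hb : b ≤ T) :
    (b - a) * ‖f b‖ ^ 2 ≤ ∫ τ in a..b, 2 * (‖f τ‖ ^ 2 + τ ^ 2 * ‖f' τ‖ ^ 2) := by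
  have hsub : Set.Icc a b ⊆ Set.Icc 0 T := Set.Icc_subset_Icc ha hb
  have hf : ContinuousOn f (Set.Icc 0 T) := fun t ht => (hderiv t ht).continuousWithinAt
  have key := intervalIntegral.sub_le_integral_of_hasDeriv_right_of_le
    (g := fun t => (t - a) * ‖f t‖ ^ 2)
    (g' := fun t => 1 * ‖f t‖ ^ 2 + (t - a) * (2 * inner ℝ (f t) (f' t)))
    (φ := fun τ : ℝ => 2 * (‖f τ‖ ^ 2 + τ ^ 2 * ‖f' τ‖ ^ 2)) hab
    (((continuousOn_id.sub continuousOn_const).mul (hf.norm.pow 2)).mono hsub)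
    (by
      intro x hx
      have hx0 : 0 < x := ha.trans_lt hx.1
      have hxT : x < T := hx.2.trans_le hb
      have h1 : HasDerivAt f (f' x) x :=
        (hderiv x ⟨hx0.le, hxT.le⟩).hasDerivAt (Icc_mem_nhds hx0 hxT)
      exact (((hasDerivAt_id x).sub_const a).mul h1.norm_sq).hasDerivWithinAt)
    ((hc.mono hsub).integrableOn_Icc)
    (by
      intro x hx
      have h1 : inner ℝ (f x) (f' x) ≤ ‖f x‖ * ‖f' x‖ := real_inner_le_norm _ _
      have h2 : 0 < x - a := sub_pos.2 hx.1
      have h3 := mul_le_mul_of_nonneg_left h1 h2.le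
      have h4 : (x - a) * (‖f x‖ * ‖f' x‖) ≤ x * (‖f x‖ * ‖f' x‖) :=
        mul_le_mul_of_nonneg_right (by linarith) (by positivity)
      have h5 := sq_nonneg (‖f x‖ - x * ‖f' x‖)
      have h6 := sq_nonneg (x * ‖f' x‖)
      nlinarith)
  simpa using key

/-- Let `H` be a real Hilbert space, `T > 0`, `M ∈ ℕ`, `Δτ = T/M` and `τ_m = mΔτ`.
Let `f : [0,T] → H` be continuously differentiable (with derivative `f'`). Then
`∑_{m=1}^M Δτ ‖f(τ_m)‖² ≤ 2 ∫_0^T (‖f(τ)‖² + τ² ‖f'(τ)‖²) dτ`. -/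
theorem stmt_14 {H : Type*} [NormedAddCommGroup H] [InnerProductSpace ℝ H] [CompleteSpace H]
    (T : ℝ) (hT : 0 < T) (M : ℕ) (hM : 0 < M) (f f' : ℝ → H)
    (hderiv : ∀ t ∈ Set.Icc (0:ℝ) T, HasDerivWithinAt f (f' t) (Set.Icc (0:ℝ) T) t)
    (hcont : ContinuousOn f' (Set.Icc (0:ℝ) T)) :
    ∑ m ∈ Finset.Icc 1 M, (T / M) * ‖f ((m : ℝ) * (T / M))‖ ^ 2
      ≤ 2 * ∫ τ in (0:ℝ)..T, (‖f τ‖ ^ 2 + τ ^ 2 * ‖f' τ‖ ^ 2) := by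
  have hf : ContinuousOn f (Set.Icc 0 T) := fun t ht => (hderiv t ht).continuousWithinAt
  have hc : ContinuousOn (fun τ : ℝ => 2 * (‖f τ‖ ^ 2 + τ ^ 2 * ‖f' τ‖ ^ 2))
      (Set.Icc (0:ℝ) T) :=
    continuousOn_const.mul ((hf.norm.pow 2).add ((continuousOn_id.pow 2).mul (hcont.norm.pow 2)))
  have hM' : (0:ℝ) < M := by exact_mod_cast hM
  have hd : 0 < T / M := div_pos hT hM'
  have hMT : (M : ℝ) * (T / M) = T := by field_simp
  rw [← intervalIntegral.integral_const_mul]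
  have main : ∀ n : ℕ, n ≤ M → ∑ m ∈ Finset.Icc 1 n, (T / M) * ‖f ((m : ℝ) * (T / M))‖ ^ 2
      ≤ ∫ τ in (0:ℝ)..(n * (T / M)), 2 * (‖f τ‖ ^ 2 + τ ^ 2 * ‖f' τ‖ ^ 2) := by
    intro n
    induction n with
    | zero => intro _; simp
    | succ k ih =>
      intro hk
      have ih := ih (by omega)
      have ha : 0 ≤ (k : ℝ) * (T / M) := by positivity
      have hab : (k : ℝ) * (T / M) ≤ ((k + 1 : ℕ) : ℝ) * (T / M) := by
        push_cast; nlinarith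
      have hb : ((k + 1 : ℕ) : ℝ) * (T / M) ≤ T := by
        have : ((k + 1 : ℕ) : ℝ) ≤ M := by exact_mod_cast hk
        calc _ ≤ (M : ℝ) * (T / M) := mul_le_mul_of_nonneg_right this hd.le
          _ = T := hMT
      have hs := aux_step T f f' hderiv hc _ _ ha hab hb
      have e : ((k + 1 : ℕ) : ℝ) * (T / M) - (k : ℝ) * (T / M) = T / M := by
        push_cast; ring
      rw [e] at hs
      rw [Finset.sum_Icc_succ_top (by omega),
        ← intervalIntegral.integral_add_adjacent_intervals
          (b := (k : ℝ) * (T / M))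
          ((hc.mono (Set.Icc_subset_Icc le_rfl (hab.trans hb))).intervalIntegrable_of_Icc ha)
          ((hc.mono (Set.Icc_subset_Icc ha hb)).intervalIntegrable_of_Icc hab)]
      exact add_le_add ih hs
  have := main M le_rfl
  rwa [hMT] at this
end
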